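/- On the flat d-torus 𝕋^d with geodesic metric and normalized Haar measure σ, for d − 2 ≤ s < d the Haar measure σ minimizes the Riesz s-energy I_{K_s}(μ) = ∫∫ K_s(x,y) dμ(x) dμ(y) over all Borel probability measures μ, and moreover for d − 2 < s < d every minimizing measure has full support. -/

import Mathlib

open MeasureTheory Set ENNReal

noncomputable section

instance : Fact (0 < 2 * Real.pi) := ⟨by positivity⟩

/-- The flat `d`-torus `(ℝ/2πℤ)^d`. -/
abbrev Torus (d : ℕ) := Fin d → AddCircle (2 * Real.pi)

/-- The flat (Euclidean quotient) metric on the torus. -/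
def tdist {d : ℕ} (x y : Torus d) : ℝ := Real.sqrt (∑ i, dist (x i) (y i) ^ 2)

/-- The normalized Haar (uniform) measure on the torus. -/
def tHaar (d : ℕ) : Measure (Torus d) := (ENNReal.ofReal ((2 * Real.pi) ^ d))⁻¹ • volume

/-- The Riesz kernel `K_s` on the flat torus, with values in the extended reals. -/
def rieszK {d : ℕ} (s : ℝ) (x y : Torus d) : EReal :=
  if 0 < s then ((ENNReal.ofReal (tdist x y) ^ (-s) : ℝ≥0∞) : EReal)
  else if s = 0 then
    (if tdist x y = 0 then (⊤ : EReal) else ((-Real.log (tdist x y) : ℝ) : EReal))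
  else ((-(tdist x y ^ (-s)) : ℝ) : EReal)

/-- Map an extended real to an extended nonnegative real. -/
def toe (x : EReal) : ℝ≥0∞ := if x = ⊤ then ⊤ else ENNReal.ofReal x.toReal

/-- The energy of a measure with respect to an `EReal`-valued kernel, as the difference
of the energies of the positive and negative parts of the kernel. -/
def eEnergy {Ω : Type*} [MeasurableSpace Ω] (K : Ω → Ω → EReal) (μ : Measure Ω) : EReal :=
  ((∫⁻ x, ∫⁻ y, toe (K x y) ∂μ ∂μ : ℝ≥0∞) : EReal) -
    ((∫⁻ x, ∫⁻ y, toe (-(K x y)) ∂μ ∂μ : ℝ≥0∞) : EReal)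

/-- The support of a Borel measure. -/
def msupp {Ω : Type*} [TopologicalSpace Ω] [MeasurableSpace Ω] (μ : Measure Ω) : Set Ω :=
  {x | ∀ V : Set Ω, IsOpen V → x ∈ V → 0 < μ V}

open Filter Topology

/-- A radial profile, as a function of the squared distance, comparable with the Riesz kernel of
exponent `s` in dimension `d`: its derivative is a negative multiple of `u ^ (-(s / 2 + 1))`, and it
grows at most like a power of order less than `d`. -/
structure RieszProfile (d : ℕ) (s : ℝ) (φ : ℝ → ℝ) : Prop where
  measurable : Measurable φ
  hasDerivAt : ∃ c : ℝ, 0 < c ∧ ∀ u : ℝ, 0 < u → HasDerivAt φ (-(c * u ^ (-(s / 2 + 1)))) u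
  nonneg : ∀ u : ℝ, 0 < u → u ≤ d * Real.pi ^ 2 + 1 → 0 ≤ φ u
  growth : ∃ q A B : ℝ, 0 < q ∧ q < d ∧ 0 ≤ A ∧ 0 ≤ B ∧ ∀ r H : ℝ, 0 < r → 0 < H →
    H ^ 2 ≤ d * Real.pi ^ 2 + 1 → φ (r ^ 2) ≤ (A * φ (H ^ 2) + B) * (1 + (H / r) ^ q)

lemma RieszProfile.antitoneOn {d : ℕ} {s : ℝ} {φ : ℝ → ℝ} (h : RieszProfile d s φ) :
    AntitoneOn φ (Ioi 0) := by
  obtain ⟨c, hc, hφ⟩ := h.hasDerivAt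
  refine antitoneOn_of_deriv_nonpos (convex_Ioi 0)
    (fun u hu => (hφ u hu).continuousAt.continuousWithinAt)
    (fun u hu => (hφ u (interior_subset hu)).differentiableAt.differentiableWithinAt) ?_
  intro u hu
  have hu : 0 < u := interior_subset hu
  rw [(hφ u hu).deriv]
  have : 0 < u ^ (-(s / 2 + 1)) := Real.rpow_pos_of_pos hu _
  nlinarith [mul_pos hc this]

/-- The fundamental cube `[-π, π]^d`. -/
def cube (d : ℕ) : Set (Fin d → ℝ) := Icc (fun _ => -Real.pi) (fun _ => Real.pi)

lemma isCompact_cube (d : ℕ) : IsCompact (cube d) := isCompact_Icc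

lemma sum_sq_le_of_mem_cube {d : ℕ} {x : Fin d → ℝ} (hx : x ∈ cube d) :
    ∑ i, x i ^ 2 ≤ d * Real.pi ^ 2 := by
  calc ∑ i, x i ^ 2 ≤ ∑ _i : Fin d, Real.pi ^ 2 := by
        refine Finset.sum_le_sum fun i _ => ?_
        have h1 := hx.1 i
        have h2 := hx.2 i
        simp only at h1 h2
        nlinarith
    _ = d * Real.pi ^ 2 := by simp

lemma sum_sq_eq_zero_iff {d : ℕ} {x : Fin d → ℝ} : ∑ i, x i ^ 2 = 0 ↔ x = 0 := by
  rw [Finset.sum_eq_zero_iff_of_nonneg (fun i _ => sq_nonneg _)]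
  simp [funext_iff]

/-- Green's identity on the cube for a regularized radial profile: the boundary terms have a
favourable sign. -/
lemma integral_laplacian_le {n : ℕ} {φ : ℝ → ℝ} {c p : ℝ} (hc : 0 < c)
    (hφ : ∀ u : ℝ, 0 < u → HasDerivAt φ (-(c * u ^ (-p))) u) (k : Fin (n + 1) → ℤ) {e : ℝ}
    (he : 0 < e) :
    ∫ x in cube (n + 1), (1 - Real.cos (∑ i, k i * x i)) *
        (c * (∑ i, x i ^ 2 + e) ^ (-p - 1) *
          ((4 * p - 2 * (n + 1 : ℕ)) * ∑ i, x i ^ 2 - 2 * (n + 1 : ℕ) * e)) ≤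
      (∑ i, (k i : ℝ) ^ 2) * ∫ x in cube (n + 1), φ (∑ i, x i ^ 2 + e) *
        Real.cos (∑ i, k i * x i) := by
  set u : (Fin (n + 1) → ℝ) → ℝ := fun x => ∑ i, x i ^ 2 + e with hu_def
  set θ : (Fin (n + 1) → ℝ) → ℝ := fun x => ∑ i, k i * x i with hθ_def
  have hu : ∀ x, 0 < u x := fun x => by
    have : 0 ≤ ∑ i, x i ^ 2 := Finset.sum_nonneg fun i _ => sq_nonneg _
    simp only [hu_def]; linarith
  have hθc : Continuous θ := by fun_prop
  have huc : Continuous u := by fun_prop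
  have hup : ∀ r : ℝ, Continuous fun x => u x ^ r := fun r =>
    huc.rpow_const fun x => Or.inl (hu x).ne'
  have hφc : Continuous fun x => φ (u x) :=
    continuous_iff_continuousAt.2 fun x =>
      ContinuousAt.comp (f := u) (hφ _ (hu x)).continuousAt huc.continuousAt
  set V : Fin (n + 1) → (Fin (n + 1) → ℝ) → ℝ := fun i x =>
    -(2 * c) * (x i * u x ^ (-p) * (1 - Real.cos (θ x))) - k i * (φ (u x) * Real.sin (θ x))
    with hV_def
  have hVc : ∀ i, Continuous (V i) := fun i => by
    exact (continuous_const.mul (((continuous_apply i).mul (hup (-p))).mul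
      (continuous_const.sub (Real.continuous_cos.comp hθc)))).sub
      (continuous_const.mul (hφc.mul (Real.continuous_sin.comp hθc)))
  let Lu : (Fin (n + 1) → ℝ) → (Fin (n + 1) → ℝ) →L[ℝ] ℝ := fun x =>
    ∑ i, (2 * x i) • ContinuousLinearMap.proj (R := ℝ) (φ := fun _ : Fin (n + 1) => ℝ) i
  let Lθ : (Fin (n + 1) → ℝ) →L[ℝ] ℝ :=
    ∑ i, (k i : ℝ) • ContinuousLinearMap.proj (R := ℝ) (φ := fun _ : Fin (n + 1) => ℝ) i
  have hLu : ∀ x i, Lu x (Pi.single i 1) = 2 * x i := fun x i => by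
    simp [Lu, Pi.single_apply]
  have hLθ : ∀ i, Lθ (Pi.single i 1) = k i := fun i => by
    simp [Lθ, Pi.single_apply]
  have hud : ∀ x, HasFDerivAt u (Lu x) x := fun x => by
    refine HasFDerivAt.add_const e (HasFDerivAt.fun_sum fun i _ => ?_)
    have := (hasFDerivAt_apply (𝕜 := ℝ) i x).pow 2
    simpa using this
  have hθd : ∀ x, HasFDerivAt θ Lθ x := fun x =>
    HasFDerivAt.fun_sum fun i _ => (hasFDerivAt_apply (𝕜 := ℝ) i x).const_mul (k i : ℝ)
  let V' : Fin (n + 1) → (Fin (n + 1) → ℝ) → (Fin (n + 1) → ℝ) →L[ℝ] ℝ := fun i x =>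
    fderiv ℝ (V i) x
  have hVd : ∀ i x, HasFDerivAt (V i) (V' i x) x ∧ V' i x (Pi.single i 1) =
      -(2 * c) * ((u x ^ (-p) - 2 * p * x i ^ 2 * u x ^ (-p - 1)) * (1 - Real.cos (θ x)))
        - (k i : ℝ) ^ 2 * (φ (u x) * Real.cos (θ x)) := fun i x => by
    have h1 := (Real.hasDerivAt_rpow_const (p := -p) (Or.inl (hu x).ne')).comp_hasFDerivAt x (hud x)
    have h2 := (Real.hasDerivAt_cos (θ x)).comp_hasFDerivAt x (hθd x)
    have h3 := (Real.hasDerivAt_sin (θ x)).comp_hasFDerivAt x (hθd x)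
    have h4 := (hφ _ (hu x)).comp_hasFDerivAt x (hud x)
    have h5 := hasFDerivAt_apply (𝕜 := ℝ) i x
    have H := (((h5.mul h1).mul (h2.const_sub 1)).const_mul (-(2 * c))).sub
      ((h4.mul h3).const_mul (k i : ℝ))
    have H' : HasFDerivAt (V i) _ x := H
    refine ⟨H'.differentiableAt.hasFDerivAt, ?_⟩
    simp only [V', H'.fderiv]
    simp [hLu, hLθ]
    ring
  have hdiv : ∀ x, ∑ i, V' i x (Pi.single i 1) =
      (1 - Real.cos (θ x)) * (c * u x ^ (-p - 1) *
          ((4 * p - 2 * (n + 1 : ℕ)) * ∑ i, x i ^ 2 - 2 * (n + 1 : ℕ) * e)) -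
        (∑ i, (k i : ℝ) ^ 2) * (φ (u x) * Real.cos (θ x)) := fun x => by
    have hpow : u x ^ (-p) = u x ^ (-p - 1) * u x := by
      rw [← Real.rpow_add_one (hu x).ne']; ring_nf
    simp only [(hVd _ x).2, hpow]
    rw [Finset.sum_sub_distrib, ← Finset.mul_sum, ← Finset.sum_mul, ← Finset.sum_mul,
      Finset.sum_sub_distrib, ← Finset.sum_mul, ← Finset.sum_mul, ← Finset.mul_sum]
    simp only [Finset.sum_const, Finset.card_univ, Fintype.card_fin, nsmul_eq_mul]
    simp only [hu_def]
    ring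
  have hle : (fun _ : Fin (n + 1) => -Real.pi) ≤ fun _ => Real.pi := fun _ => by
    simp only; linarith [Real.pi_pos]
  have hcont1 : Continuous fun x => (1 - Real.cos (θ x)) * (c * u x ^ (-p - 1) *
          ((4 * p - 2 * (n + 1 : ℕ)) * ∑ i, x i ^ 2 - 2 * (n + 1 : ℕ) * e)) := by
    have := hup (-p - 1)
    fun_prop
  have hcont2 : Continuous fun x => (φ (u x) * Real.cos (θ x)) :=
    hφc.mul (Real.continuous_cos.comp hθc)
  have hcont3 : Continuous fun x => (∑ i, (k i : ℝ) ^ 2) * (φ (u x) * Real.cos (θ x)) :=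
    continuous_const.mul hcont2
  have hcInt : ∀ f : (Fin (n + 1) → ℝ) → ℝ, Continuous f → IntegrableOn f (cube (n + 1)) :=
    fun f hf => hf.continuousOn.integrableOn_compact (isCompact_cube _)
  have key := integral_divergence_of_hasFDerivAt_off_countable' (fun _ : Fin (n + 1) => -Real.pi)
    (fun _ => Real.pi) hle V V' ∅ countable_empty (fun i => (hVc i).continuousOn)
    (fun x _ i => (hVd i x).1) (by
      simp only [hdiv]
      exact hcInt _ (hcont1.sub hcont3))
  simp only [hdiv] at key
  change ∫ x in cube (n + 1), _ = _ at key
  rw [integral_sub (hcInt _ hcont1) (hcInt _ hcont3),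
    integral_const_mul] at key
  suffices h : ∀ i : Fin (n + 1), (∫ x in Icc ((fun _ : Fin (n + 1) => -Real.pi) ∘ i.succAbove)
      ((fun _ : Fin (n + 1) => Real.pi) ∘ i.succAbove), V i (i.insertNth Real.pi x)) ≤
      ∫ x in Icc ((fun _ : Fin (n + 1) => -Real.pi) ∘ i.succAbove)
      ((fun _ : Fin (n + 1) => Real.pi) ∘ i.succAbove), V i (i.insertNth (-Real.pi) x) by
    have := Finset.sum_nonpos fun i (_ : i ∈ Finset.univ) => sub_nonpos.2 (h i)
    linarith
  intro i
  have hci : ∀ t : ℝ, Continuous fun x : Fin n → ℝ => V i (i.insertNth t x) := fun t =>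
    (hVc i).comp (Continuous.finInsertNth i continuous_const continuous_id)
  refine integral_mono ((hci _).continuousOn.integrableOn_compact isCompact_Icc)
    ((hci _).continuousOn.integrableOn_compact isCompact_Icc) fun x => ?_
  have hu_eq : u (i.insertNth (-Real.pi) x) = u (i.insertNth Real.pi x) := by
    simp [hu_def, Fin.sum_univ_succAbove _ i]
  have hθ_eq : θ (i.insertNth Real.pi x) =
      θ (i.insertNth (-Real.pi) x) + k i * (2 * Real.pi) := by
    simp [hθ_def, Fin.sum_univ_succAbove _ i]; ring
  simp only [hV_def, hu_eq, hθ_eq, Real.cos_add_int_mul_two_pi, Real.sin_add_int_mul_two_pi,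
    Fin.insertNth_apply_same]
  have h1 : 0 < u (i.insertNth Real.pi x) ^ (-p) := Real.rpow_pos_of_pos (hu _) _
  have h2 : 0 ≤ 1 - Real.cos (θ (i.insertNth (-Real.pi) x)) := by
    linarith [Real.cos_le_one (θ (i.insertNth (-Real.pi) x))]
  have h3 : 0 ≤ c * (Real.pi * u (i.insertNth Real.pi x) ^ (-p) *
      (1 - Real.cos (θ (i.insertNth (-Real.pi) x)))) :=
    mul_nonneg hc.le (mul_nonneg (mul_nonneg Real.pi_pos.le h1.le) h2)
  linarith

/-- The truncated power `(H / |t|) ^ a` on `[-H, H]`. -/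
def truncPow (a H t : ℝ) : ℝ := if |t| ≤ H then (H / |t|) ^ a else 0

lemma truncPow_nonneg {a H : ℝ} (hH : 0 ≤ H) (t : ℝ) : 0 ≤ truncPow a H t := by
  unfold truncPow
  split_ifs <;> positivity

lemma truncPow_abs (a H t : ℝ) : truncPow a H |t| = truncPow a H t := by
  simp [truncPow]

lemma measurable_truncPow (a H : ℝ) : Measurable (truncPow a H) := by
  unfold truncPow
  refine Measurable.ite (measurableSet_le (by fun_prop) measurable_const) ?_ measurable_const
  fun_prop

lemma setIntegral_truncPow {a H : ℝ} (ha : a < 1) (hH : 0 < H) :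
    IntegrableOn (truncPow a H) (Ioi 0) ∧ ∫ t in Ioi 0, truncPow a H t = H / (1 - a) := by
  have heq : ∀ t ∈ Ioi (0 : ℝ), truncPow a H t =
      (Ioc 0 H).indicator (fun t => H ^ a * t ^ (-a)) t := by
    intro t ht
    have ht : 0 < t := ht
    unfold truncPow
    rw [abs_of_pos ht, indicator_apply]
    by_cases h : t ≤ H
    · rw [if_pos h, if_pos ⟨ht, h⟩, Real.div_rpow hH.le ht.le, Real.rpow_neg ht.le]
      rfl
    · rw [if_neg h, if_neg fun h' => h h'.2]
  have hcInt : IntegrableOn (fun t : ℝ => H ^ a * t ^ (-a)) (Ioc 0 H) :=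
    ((intervalIntegral.intervalIntegrable_rpow' (by linarith : -1 < -a)).1).const_mul _
  constructor
  · refine IntegrableOn.congr_fun ?_ (fun t ht => (heq t ht).symm) measurableSet_Ioi
    rw [integrableOn_indicator_iff measurableSet_Ioc]
    exact hcInt.mono_set inter_subset_left
  · rw [setIntegral_congr_fun measurableSet_Ioi heq, setIntegral_indicator measurableSet_Ioc,
      inter_eq_self_of_subset_right Ioc_subset_Ioi_self, ← intervalIntegral.integral_of_le hH.le,
      intervalIntegral.integral_const_mul, integral_rpow (Or.inl (by linarith)),
      Real.zero_rpow (by linarith), sub_zero, mul_div_assoc', ← Real.rpow_add hH,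
      show a + (-a + 1) = 1 by ring, Real.rpow_one]
    ring_nf

lemma integral_truncPow {a H : ℝ} (ha : a < 1) (hH : 0 < H) :
    ∫ t, truncPow a H t = 2 * (H / (1 - a)) := by
  have := integral_comp_abs (f := truncPow a H)
  simp only [truncPow_abs] at this
  rw [this, (setIntegral_truncPow ha hH).2]

lemma integrable_truncPow {a H : ℝ} (ha : a < 1) (hH : 0 < H) : Integrable (truncPow a H) := by
  refine Integrable.of_integral_ne_zero ?_
  rw [integral_truncPow ha hH]
  have : 0 < 1 - a := by linarith
  positivity

/-- Radial powers are controlled by products of one-dimensional powers. -/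
lemma one_add_rpow_le_prod_truncPow {d : ℕ} (hd : 0 < d) {q H : ℝ} (hq : 0 < q)
    {v : Fin d → ℝ} (hv : ∀ i, v i ≠ 0) (hvH : ∀ i, |v i| ≤ H) :
    1 + (H / √(∑ i, v i ^ 2)) ^ q ≤ 2 * ∏ i, truncPow (q / d) H (v i) := by
  have hd' : (0 : ℝ) < d := by exact_mod_cast hd
  have hv' : ∀ i, 0 < |v i| := fun i => abs_pos.2 (hv i)
  have i0 : Fin d := ⟨0, hd⟩
  have hH : 0 < H := (hv' i0).trans_le (hvH i0)
  have hle : ∀ i, |v i| ≤ √(∑ i, v i ^ 2) := fun i => by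
    refine Real.le_sqrt_of_sq_le ?_
    rw [sq_abs]
    exact Finset.single_le_sum (f := fun i => v i ^ 2) (fun i _ => sq_nonneg _) (Finset.mem_univ i)
  have hr : 0 < √(∑ i, v i ^ 2) := (hv' i0).trans_le (hle i0)
  have h1 : (1 : ℝ) ≤ ∏ i, truncPow (q / d) H (v i) := by
    refine Finset.one_le_prod fun i _ => ?_
    rw [truncPow, if_pos (hvH i)]
    exact Real.one_le_rpow ((one_le_div (hv' i)).2 (hvH i)) (by positivity)
  have h2 : (H / √(∑ i, v i ^ 2)) ^ q ≤ ∏ i, truncPow (q / d) H (v i) := by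
    calc (H / √(∑ i, v i ^ 2)) ^ q = ∏ _i : Fin d, (H / √(∑ i, v i ^ 2)) ^ (q / d) := by
          rw [Finset.prod_const, Finset.card_univ, Fintype.card_fin, ← Real.rpow_natCast,
            ← Real.rpow_mul (by positivity), div_mul_cancel₀ _ hd'.ne']
      _ ≤ _ := by
          refine Finset.prod_le_prod (fun i _ => by positivity) fun i _ => ?_
          rw [truncPow, if_pos (hvH i)]
          have := hv' i
          have := hle i
          gcongr
  linarith

lemma ae_forall_ne_zero (d : ℕ) : ∀ᵐ x : Fin d → ℝ, ∀ i, x i ≠ 0 := by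
  rw [ae_all_iff]
  intro i
  exact Measure.ae_eval_ne (fun _ : Fin d => (volume : Measure ℝ)) i 0

lemma integrable_prod_truncPow (d : ℕ) {a H : ℝ} (ha : a < 1) (hH : 0 < H) :
    Integrable fun x : Fin d → ℝ => ∏ i, truncPow a H (x i) :=
  Integrable.fintype_prod fun _ => integrable_truncPow ha hH

lemma integrableOn_cube_one_add_rpow {d : ℕ} (hd : 0 < d) {q : ℝ} (hq : 0 < q) (hqd : q < d) :
    IntegrableOn (fun x : Fin d → ℝ => 1 + (Real.pi / √(∑ i, x i ^ 2)) ^ q) (cube d) := by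
  have hd' : (0 : ℝ) < d := by exact_mod_cast hd
  refine Integrable.mono' (((integrable_prod_truncPow d ((div_lt_one hd').2 hqd)
    Real.pi_pos).const_mul 2).integrableOn (s := cube d))
    (Measurable.aestronglyMeasurable (by fun_prop)) ?_
  filter_upwards [ae_restrict_of_ae (ae_forall_ne_zero d),
    ae_restrict_mem (isCompact_cube d).measurableSet] with x hx hxc
  rw [Real.norm_of_nonneg (by positivity)]
  exact one_add_rpow_le_prod_truncPow hd hq hx fun i => abs_le.2 ⟨hxc.1 i, hxc.2 i⟩

lemma sum_sq_pos {d : ℕ} (hd : 0 < d) {x : Fin d → ℝ} (hx : ∀ i, x i ≠ 0) : 0 < ∑ i, x i ^ 2 := by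
  have : Nonempty (Fin d) := ⟨⟨0, hd⟩⟩
  exact Finset.sum_pos (fun i _ => by have := hx i; positivity) Finset.univ_nonempty

lemma RieszProfile.integrableOn_cube {d : ℕ} (hd : 0 < d) {s : ℝ} {φ : ℝ → ℝ}
    (h : RieszProfile d s φ) : IntegrableOn (fun x => φ (∑ i, x i ^ 2)) (cube d) := by
  obtain ⟨q, A, B, hq, hqd, hA, hB, hg⟩ := h.growth
  have hd' : (1 : ℝ) ≤ d := by exact_mod_cast hd
  refine Integrable.mono' ((integrableOn_cube_one_add_rpow hd hq hqd).const_mul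
    (A * φ (Real.pi ^ 2) + B)) (h.measurable.comp (by fun_prop)).aestronglyMeasurable ?_
  filter_upwards [ae_restrict_of_ae (ae_forall_ne_zero d),
    ae_restrict_mem (isCompact_cube d).measurableSet] with x hx hxc
  have hpos := sum_sq_pos hd hx
  rw [Real.norm_of_nonneg (h.nonneg _ hpos (by linarith [sum_sq_le_of_mem_cube hxc]))]
  have := hg (√(∑ i, x i ^ 2)) Real.pi (Real.sqrt_pos.2 hpos) Real.pi_pos
    (by nlinarith [sq_nonneg Real.pi])
  rwa [Real.sq_sqrt hpos.le] at this

lemma one_sub_cos_le {d : ℕ} (k x : Fin d → ℝ) :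
    1 - Real.cos (∑ i, k i * x i) ≤ (∑ i, k i ^ 2) / 2 * ∑ i, x i ^ 2 := by
  have h1 := Real.one_sub_sq_div_two_le_cos (x := ∑ i, k i * x i)
  have h2 := Finset.sum_mul_sq_le_sq_mul_sq Finset.univ k x
  linarith

lemma tendsto_integral_regularization {d : ℕ} (hd : 0 < d) {s p : ℝ} (hs : s < d)
    (hp : p = s / 2 + 1) (k : Fin d → ℝ) {e : ℕ → ℝ} (he : ∀ m, 0 < e m) (he1 : ∀ m, e m ≤ 1)
    (het : Tendsto e atTop (𝓝 0)) :
    Tendsto (fun m => ∫ x in cube d, (1 - Real.cos (∑ i, k i * x i)) *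
      (e m * (∑ i, x i ^ 2 + e m) ^ (-p - 1))) atTop (𝓝 0) := by
  have hd' : (1 : ℝ) ≤ d := by exact_mod_cast hd
  set q := max s (1 / 2) with hq_def
  have hq : 0 < q := lt_max_of_lt_right (by norm_num)
  have hqd : q < d := max_lt hs (by linarith)
  have hsq : s ≤ q := le_max_left _ _
  set M : ℝ := d * Real.pi ^ 2 + 1 with hM
  have key : Tendsto (fun m => ∫ x in cube d, (1 - Real.cos (∑ i, k i * x i)) *
      (e m * (∑ i, x i ^ 2 + e m) ^ (-p - 1))) atTop (𝓝 (∫ _x in cube d, (0 : ℝ))) := by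
    refine tendsto_integral_of_dominated_convergence _ (fun m => ?_)
      ((integrableOn_cube_one_add_rpow hd hq hqd).const_mul
        ((∑ i, k i ^ 2) / 2 * M ^ ((q - s) / 2) * (Real.pi ^ q)⁻¹)) (fun m => ?_) ?_
    · exact Measurable.aestronglyMeasurable (by fun_prop)
    · filter_upwards [ae_restrict_of_ae (ae_forall_ne_zero d),
        ae_restrict_mem (isCompact_cube d).measurableSet] with x hx hxc
      have hr := sum_sq_pos hd hx
      have hrM := sum_sq_le_of_mem_cube hxc
      have hcos := one_sub_cos_le k x
      set r := ∑ i, x i ^ 2 with hr_def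
      have hu : 0 < r + e m := by linarith [he m]
      have huM : r + e m ≤ M := by linarith [he1 m]
      have hc0 : 0 ≤ 1 - Real.cos (∑ i, k i * x i) := by
        linarith [Real.cos_le_one (∑ i, k i * x i)]
      have hem := he m
      have hk : 0 ≤ ∑ i, k i ^ 2 := Finset.sum_nonneg fun i _ => sq_nonneg _
      rw [Real.norm_of_nonneg (by positivity)]
      calc (1 - Real.cos (∑ i, k i * x i)) * (e m * (r + e m) ^ (-p - 1))
          ≤ ((∑ i, k i ^ 2) / 2 * r) * (e m * (r + e m) ^ (-p - 1)) := by gcongr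
        _ = (∑ i, k i ^ 2) / 2 * ((r * e m) * (r + e m) ^ (-p - 1)) := by ring
        _ ≤ (∑ i, k i ^ 2) / 2 * (((r + e m) ^ (2 : ℝ)) * (r + e m) ^ (-p - 1)) := by
            gcongr
            rw [Real.rpow_two]
            nlinarith
        _ = (∑ i, k i ^ 2) / 2 * ((r + e m) ^ ((q - s) / 2) * (r + e m) ^ (-(q / 2))) := by
            rw [← Real.rpow_add hu, ← Real.rpow_add hu]
            congr 2
            rw [hp]; ring
        _ ≤ (∑ i, k i ^ 2) / 2 * (M ^ ((q - s) / 2) * r ^ (-(q / 2))) := by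
            gcongr ?_ * (?_ * ?_)
            · exact Real.rpow_le_rpow hu.le huM (by linarith)
            · exact Real.rpow_le_rpow_of_nonpos hr (by linarith) (by linarith)
        _ = (∑ i, k i ^ 2) / 2 * M ^ ((q - s) / 2) * (Real.pi ^ q)⁻¹ * (Real.pi / √r) ^ q := by
            rw [Real.div_rpow Real.pi_pos.le (Real.sqrt_nonneg _), Real.sqrt_eq_rpow,
              ← Real.rpow_mul hr.le, Real.rpow_neg hr.le]
            have : (0 : ℝ) < Real.pi ^ q := Real.rpow_pos_of_pos Real.pi_pos _
            field_simp
        _ ≤ _ := by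
            have : 0 ≤ M := by positivity
            gcongr
            linarith
    · filter_upwards [ae_restrict_of_ae (ae_forall_ne_zero d)] with x hx
      have hr := sum_sq_pos hd hx
      have h1 : Tendsto (fun m => ∑ i, x i ^ 2 + e m) atTop (𝓝 (∑ i, x i ^ 2 + 0)) :=
        tendsto_const_nhds.add het
      have h2 := h1.rpow_const (p := -p - 1) (Or.inl (by simpa using hr.ne'))
      simpa using (tendsto_const_nhds (x := 1 - Real.cos (∑ i, k i * x i))).mul (het.mul h2)
  simpa using key

lemma RieszProfile.tendsto_integral {d : ℕ} (hd : 0 < d) {s : ℝ} {φ : ℝ → ℝ}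
    (h : RieszProfile d s φ) (k : Fin d → ℝ) {e : ℕ → ℝ} (he : ∀ m, 0 < e m)
    (he1 : ∀ m, e m ≤ 1) (het : Tendsto e atTop (𝓝 0)) :
    Tendsto (fun m => ∫ x in cube d, φ (∑ i, x i ^ 2 + e m) * Real.cos (∑ i, k i * x i)) atTop
      (𝓝 (∫ x in cube d, φ (∑ i, x i ^ 2) * Real.cos (∑ i, k i * x i))) := by
  obtain ⟨c, hc, hφ⟩ := h.hasDerivAt
  refine tendsto_integral_of_dominated_convergence _ (fun m => ?_) (h.integrableOn_cube hd)
    (fun m => ?_) ?_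
  · exact ((h.measurable.comp (by fun_prop)).mul (by fun_prop)).aestronglyMeasurable
  · filter_upwards [ae_restrict_of_ae (ae_forall_ne_zero d),
      ae_restrict_mem (isCompact_cube d).measurableSet] with x hx hxc
    have hr := sum_sq_pos hd hx
    have hrM := sum_sq_le_of_mem_cube hxc
    have hem := he m
    have hu : 0 < ∑ i, x i ^ 2 + e m := by linarith
    rw [norm_mul, Real.norm_of_nonneg (h.nonneg _ hu (by linarith [he1 m]))]
    calc φ (∑ i, x i ^ 2 + e m) * ‖Real.cos (∑ i, k i * x i)‖
        ≤ φ (∑ i, x i ^ 2 + e m) * 1 :=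
          mul_le_mul_of_nonneg_left (Real.abs_cos_le_one _)
            (h.nonneg _ hu (by linarith [he1 m]))
      _ ≤ φ (∑ i, x i ^ 2) := by
          rw [mul_one]
          exact h.antitoneOn hr hu (by linarith)
  · filter_upwards [ae_restrict_of_ae (ae_forall_ne_zero d)] with x hx
    have hr := sum_sq_pos hd hx
    have h1 : Tendsto (fun m => ∑ i, x i ^ 2 + e m) atTop (𝓝 (∑ i, x i ^ 2)) := by
      simpa using (tendsto_const_nhds (x := ∑ i, x i ^ 2)).add het
    exact ((hφ _ hr).continuousAt.tendsto.comp h1).mul_const _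

/-- The Fourier coefficients of a Riesz profile on the cube are bounded below by a nonnegative
multiple of an explicit positive quantity. -/
lemma RieszProfile.exists_le_integral_cos {d : ℕ} (hd : 0 < d) {s : ℝ} {φ : ℝ → ℝ}
    (h : RieszProfile d s φ) (hs₁ : (d : ℝ) - 2 ≤ s) (hs₂ : s < d) (k : Fin d → ℤ) :
    ∃ κ : ℝ, 0 < κ ∧ κ * (s - (d - 2)) *
        ∫ x in cube d, (1 - Real.cos (∑ i, k i * x i)) * ∑ i, x i ^ 2 ≤
      (∑ i, (k i : ℝ) ^ 2) * ∫ x in cube d, φ (∑ i, x i ^ 2) * Real.cos (∑ i, k i * x i) := by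
  obtain ⟨n, rfl⟩ : ∃ n, d = n + 1 := ⟨d - 1, by omega⟩
  obtain ⟨c, hc, hφ⟩ := h.hasDerivAt
  set p := s / 2 + 1 with hp
  set d' : ℝ := ((n + 1 : ℕ) : ℝ) with hd'
  have hd1 : 1 ≤ d' := by simp [hd']
  set M : ℝ := d' * Real.pi ^ 2 + 1 with hM
  have hMpos : 0 < M := by positivity
  have hp1 : -p - 1 ≤ 0 := by linarith
  refine ⟨2 * (c * M ^ (-p - 1)), by positivity, ?_⟩
  let e : ℕ → ℝ := fun m => 1 / ((m : ℝ) + 1)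
  have he : ∀ m, 0 < e m := fun m => by positivity
  have he1 : ∀ m, e m ≤ 1 := fun m => by
    rw [div_le_one (by positivity)]
    linarith [(Nat.cast_nonneg m : (0 : ℝ) ≤ m)]
  have het : Tendsto e atTop (𝓝 0) := tendsto_one_div_add_atTop_nhds_zero_nat
  have hlim := ((h.tendsto_integral hd (fun i => (k i : ℝ)) he he1 het).const_mul
    (∑ i, (k i : ℝ) ^ 2)).add
    ((tendsto_integral_regularization hd hs₂ hp (fun i => (k i : ℝ)) he he1 het).const_mul
      (2 * d' * c))
  rw [mul_zero, add_zero] at hlim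
  refine ge_of_tendsto' hlim fun m => ?_
  have hB := integral_laplacian_le hc hφ k (he m)
  refine le_trans ?_ (add_le_add_left hB _)
  rw [← integral_const_mul, ← integral_const_mul]
  have hup : ∀ r : ℝ, Continuous fun x : Fin (n + 1) → ℝ => (∑ i, x i ^ 2 + e m) ^ r := fun r =>
    Continuous.rpow_const (by fun_prop) fun x => Or.inl (by have := he m; positivity)
  have hup1 := hup (-p - 1)
  have hcos : Continuous fun x : Fin (n + 1) → ℝ => 1 - Real.cos (∑ i, k i * x i) := by fun_prop
  have hsq : Continuous fun x : Fin (n + 1) → ℝ => ∑ i, x i ^ 2 := by fun_prop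
  have hcInt : ∀ f : (Fin (n + 1) → ℝ) → ℝ, Continuous f → IntegrableOn f (cube (n + 1)) :=
    fun f hf => hf.continuousOn.integrableOn_compact (isCompact_cube _)
  have hi1 : IntegrableOn (fun x => (1 - Real.cos (∑ i, k i * x i)) *
      (c * (∑ i, x i ^ 2 + e m) ^ (-p - 1) *
        ((4 * p - 2 * d') * ∑ i, x i ^ 2 - 2 * d' * e m))) (cube (n + 1)) :=
    hcInt _ (hcos.mul ((continuous_const.mul hup1).mul
      ((continuous_const.mul hsq).sub continuous_const)))
  have hi2 : IntegrableOn (fun x => 2 * d' * c * ((1 - Real.cos (∑ i, k i * x i)) *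
      (e m * (∑ i, x i ^ 2 + e m) ^ (-p - 1)))) (cube (n + 1)) :=
    hcInt _ (continuous_const.mul (hcos.mul (continuous_const.mul hup1)))
  have hi3 : IntegrableOn (fun x => 2 * (c * M ^ (-p - 1)) * (s - (d' - 2)) *
      ((1 - Real.cos (∑ i, k i * x i)) * ∑ i, x i ^ 2)) (cube (n + 1)) :=
    hcInt _ (continuous_const.mul (hcos.mul hsq))
  rw [← integral_add hi1 hi2]
  refine setIntegral_mono_on hi3 (hi1.add hi2) (isCompact_cube _).measurableSet fun x hx => ?_
  have hc0 : 0 ≤ 1 - Real.cos (∑ i, k i * x i) := by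
    linarith [Real.cos_le_one (∑ i, k i * x i)]
  have hr0 : 0 ≤ ∑ i, x i ^ 2 := Finset.sum_nonneg fun i _ => sq_nonneg _
  have hle : M ^ (-p - 1) ≤ (∑ i, x i ^ 2 + e m) ^ (-p - 1) :=
    Real.rpow_le_rpow_of_nonpos (by have := he m; positivity)
      (by linarith [sum_sq_le_of_mem_cube hx, he1 m]) hp1
  have hs0 : 0 ≤ s - (d' - 2) := by linarith
  have hpd : 4 * p - 2 * d' = 2 * (s - (d' - 2)) := by rw [hp]; ring
  calc 2 * (c * M ^ (-p - 1)) * (s - (d' - 2)) *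
        ((1 - Real.cos (∑ i, k i * x i)) * ∑ i, x i ^ 2)
      ≤ 2 * (c * (∑ i, x i ^ 2 + e m) ^ (-p - 1)) * (s - (d' - 2)) *
        ((1 - Real.cos (∑ i, k i * x i)) * ∑ i, x i ^ 2) := by gcongr
    _ = _ := by
      rw [hpd]; ring

lemma sum_sq_intCast_pos {d : ℕ} {k : Fin d → ℤ} (hk : k ≠ 0) : 0 < ∑ i, (k i : ℝ) ^ 2 := by
  obtain ⟨i, hi⟩ := Function.ne_iff.1 hk
  refine Finset.sum_pos' (fun i _ => sq_nonneg _) ⟨i, Finset.mem_univ i, ?_⟩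
  have : (k i : ℝ) ≠ 0 := by exact_mod_cast hi
  positivity

lemma RieszProfile.integral_cos_nonneg {d : ℕ} (hd : 0 < d) {s : ℝ} {φ : ℝ → ℝ}
    (h : RieszProfile d s φ) (hs₁ : (d : ℝ) - 2 ≤ s) (hs₂ : s < d) {k : Fin d → ℤ} (hk : k ≠ 0) :
    0 ≤ ∫ x in cube d, φ (∑ i, x i ^ 2) * Real.cos (∑ i, k i * x i) := by
  obtain ⟨κ, hκ, hle⟩ := h.exists_le_integral_cos hd hs₁ hs₂ k
  refine nonneg_of_mul_nonneg_right (le_trans ?_ hle) (sum_sq_intCast_pos hk)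
  refine mul_nonneg (mul_nonneg hκ.le (by linarith)) (integral_nonneg fun x => ?_)
  exact mul_nonneg (by linarith [Real.cos_le_one (∑ i, k i * x i)])
    (Finset.sum_nonneg fun i _ => sq_nonneg _)

lemma RieszProfile.integral_cos_pos {d : ℕ} (hd : 0 < d) {s : ℝ} {φ : ℝ → ℝ}
    (h : RieszProfile d s φ) (hs₁ : (d : ℝ) - 2 < s) (hs₂ : s < d) {k : Fin d → ℤ} (hk : k ≠ 0) :
    0 < ∫ x in cube d, φ (∑ i, x i ^ 2) * Real.cos (∑ i, k i * x i) := by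
  obtain ⟨κ, hκ, hle⟩ := h.exists_le_integral_cos hd hs₁.le hs₂ k
  refine pos_of_mul_pos_right (lt_of_lt_of_le ?_ hle) (sum_sq_intCast_pos hk).le
  refine mul_pos (mul_pos hκ (by linarith)) ?_
  have hcont : Continuous fun x : Fin d → ℝ =>
    (1 - Real.cos (∑ i, k i * x i)) * ∑ i, x i ^ 2 := by fun_prop
  have hnn : ∀ x : Fin d → ℝ, 0 ≤ (1 - Real.cos (∑ i, k i * x i)) * ∑ i, x i ^ 2 := fun x =>
    mul_nonneg (by linarith [Real.cos_le_one (∑ i, k i * x i)])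
      (Finset.sum_nonneg fun i _ => sq_nonneg _)
  rw [setIntegral_pos_iff_support_of_nonneg_ae (Eventually.of_forall hnn)
    (hcont.continuousOn.integrableOn_compact (isCompact_cube d))]
  obtain ⟨i, hi⟩ := Function.ne_iff.1 hk
  have hi' : (k i : ℝ) ≠ 0 := by exact_mod_cast hi
  have habs : (1 : ℝ) ≤ |(k i : ℝ)| := by exact_mod_cast Int.one_le_abs hi
  -- a point of the open cube at which the integrand is positive
  let x₀ : Fin d → ℝ := Pi.single i (Real.pi / 2 / k i)
  have hx₀ : x₀ ∈ Function.support fun x : Fin d → ℝ =>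
      (1 - Real.cos (∑ i, k i * x i)) * ∑ i, x i ^ 2 := by
    have h1 : ∑ j, (k j : ℝ) * x₀ j = Real.pi / 2 := by
      simp only [x₀, Pi.single_apply, mul_ite, mul_zero, Finset.sum_ite_eq', Finset.mem_univ,
        if_true]
      field_simp
    have h2 : ∑ j, x₀ j ^ 2 ≠ 0 := by
      rw [Ne, sum_sq_eq_zero_iff]
      have := Real.pi_pos
      simp [x₀, hi']
    simp only [Function.mem_support, h1, Real.cos_pi_div_two]
    simpa using h2
  let O : Set (Fin d → ℝ) := univ.pi fun _ => Ioo (-Real.pi) Real.pi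
  have hO : IsOpen O := isOpen_set_pi finite_univ fun _ _ => isOpen_Ioo
  have hOc : O ⊆ cube d := fun x hx => ⟨fun j => (hx j trivial).1.le, fun j => (hx j trivial).2.le⟩
  have hx₀O : x₀ ∈ O := by
    intro j _
    rw [mem_Ioo, ← abs_lt]
    by_cases hj : j = i
    · subst hj
      simp only [x₀, Pi.single_eq_same]
      rw [abs_div, abs_of_pos (by positivity), div_lt_iff₀ (by positivity)]
      nlinarith [Real.pi_pos]
    · simp [x₀, hj, Real.pi_pos]
  refine lt_of_lt_of_le ((hcont.isOpen_support.inter hO).measure_pos volume ⟨x₀, hx₀, hx₀O⟩) ?_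
  exact measure_mono (inter_subset_inter_right _ hOc)

/-- The norm on the torus inducing the flat metric. -/
def tnorm {d : ℕ} (x : Torus d) : ℝ := √(∑ i, ‖x i‖ ^ 2)

lemma tdist_eq_tnorm {d : ℕ} (x y : Torus d) : tdist x y = tnorm (x - y) := by
  simp [tdist, tnorm, dist_eq_norm]

lemma tnorm_nonneg {d : ℕ} (x : Torus d) : 0 ≤ tnorm x := Real.sqrt_nonneg _

lemma tnorm_sq {d : ℕ} (x : Torus d) : tnorm x ^ 2 = ∑ i, ‖x i‖ ^ 2 :=
  Real.sq_sqrt (Finset.sum_nonneg fun _ _ => sq_nonneg _)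

lemma continuous_tnorm {d : ℕ} : Continuous (tnorm : Torus d → ℝ) := by
  unfold tnorm
  fun_prop

lemma tnorm_eq_zero {d : ℕ} {x : Torus d} : tnorm x = 0 ↔ x = 0 := by
  rw [← sq_eq_zero_iff, tnorm_sq, Finset.sum_eq_zero_iff_of_nonneg fun _ _ => sq_nonneg _]
  simp [funext_iff]

lemma tnorm_pos {d : ℕ} {x : Torus d} (hx : x ≠ 0) : 0 < tnorm x :=
  (tnorm_nonneg x).lt_of_ne fun h => hx (tnorm_eq_zero.1 h.symm)

lemma norm_circle_le (x : AddCircle (2 * Real.pi)) : ‖x‖ ≤ Real.pi := by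
  have := AddCircle.norm_le_half_period (p := 2 * Real.pi) (x := x) (by positivity)
  rw [abs_of_pos (by positivity)] at this
  linarith

lemma tnorm_sq_le {d : ℕ} (x : Torus d) : tnorm x ^ 2 ≤ d * Real.pi ^ 2 := by
  rw [tnorm_sq]
  calc ∑ i, ‖x i‖ ^ 2 ≤ ∑ _i : Fin d, Real.pi ^ 2 := by
        gcongr with i
        exact norm_circle_le _
    _ = _ := by simp

lemma tnorm_eq_norm_toLp {d : ℕ} (x : Torus d) :
    tnorm x = ‖WithLp.toLp 2 (fun i => ‖x i‖ : Fin d → ℝ)‖ := by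
  simp [tnorm, EuclideanSpace.norm_eq]

lemma tnorm_le_of_forall_le {d : ℕ} {x : Torus d} {g : Fin d → ℝ} (h : ∀ i, ‖x i‖ ≤ g i) :
    tnorm x ≤ ‖WithLp.toLp 2 g‖ := by
  rw [EuclideanSpace.norm_eq]
  unfold tnorm
  gcongr with i
  exact (h i).trans (le_abs_self _)

lemma tnorm_add_le {d : ℕ} (x y : Torus d) : tnorm (x + y) ≤ tnorm x + tnorm y := by
  refine (tnorm_le_of_forall_le (g := fun i => ‖x i‖ + ‖y i‖) fun i =>
    norm_add_le (x i) (y i)).trans ?_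
  rw [tnorm_eq_norm_toLp x, tnorm_eq_norm_toLp y]
  exact norm_add_le (WithLp.toLp 2 (fun i => ‖x i‖ : Fin d → ℝ))
    (WithLp.toLp 2 (fun i => ‖y i‖ : Fin d → ℝ))

/-- The projection from the cube to the torus. -/
def toTorus {d : ℕ} (x : Fin d → ℝ) : Torus d := fun i => (x i : AddCircle (2 * Real.pi))

lemma measurePreserving_toTorus (d : ℕ) :
    MeasurePreserving (toTorus : (Fin d → ℝ) → Torus d) (volume.restrict (cube d)) volume := by
  have h := measurePreserving_pi
    (fun _ : Fin d => (volume : Measure ℝ).restrict (Ioc (-Real.pi) Real.pi))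
    (fun _ : Fin d => (volume : Measure (AddCircle (2 * Real.pi))))
    (f := fun _ t => (t : AddCircle (2 * Real.pi))) (fun _ => by
      have := AddCircle.measurePreserving_mk (2 * Real.pi) (-Real.pi)
      rwa [show -Real.pi + 2 * Real.pi = Real.pi by ring] at this)
  rw [← Measure.restrict_pi_pi, Measure.restrict_congr_set Measure.univ_pi_Ioc_ae_eq_Icc] at h
  exact h

lemma norm_coe_circle {t : ℝ} (ht : |t| ≤ Real.pi) : ‖(t : AddCircle (2 * Real.pi))‖ = |t| := by
  refine (AddCircle.norm_coe_eq_abs_iff (p := 2 * Real.pi) (by positivity)).2 ?_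
  rw [abs_of_pos Real.two_pi_pos]
  linarith

lemma abs_le_of_mem_cube {d : ℕ} {x : Fin d → ℝ} (hx : x ∈ cube d) (i : Fin d) :
    |x i| ≤ Real.pi := abs_le.2 ⟨hx.1 i, hx.2 i⟩

lemma tnorm_toTorus_sq {d : ℕ} {x : Fin d → ℝ} (hx : x ∈ cube d) :
    tnorm (toTorus x) ^ 2 = ∑ i, x i ^ 2 := by
  rw [tnorm_sq]
  refine Finset.sum_congr rfl fun i _ => ?_
  rw [toTorus, norm_coe_circle (abs_le_of_mem_cube hx i), sq_abs]

/-- The characters of the torus. -/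
def torusChar {d : ℕ} (k : Fin d → ℤ) (x : Torus d) : ℂ := ∏ i, fourier (k i) (x i)

@[fun_prop]
lemma continuous_torusChar {d : ℕ} (k : Fin d → ℤ) : Continuous (torusChar k) := by
  unfold torusChar
  fun_prop

lemma norm_torusChar {d : ℕ} (k : Fin d → ℤ) (x : Torus d) : ‖torusChar k x‖ = 1 := by
  rw [torusChar, norm_prod]
  exact Finset.prod_eq_one fun i _ => Circle.norm_coe _

lemma torusChar_add {d : ℕ} (k : Fin d → ℤ) (x y : Torus d) :
    torusChar k (x + y) = torusChar k x * torusChar k y := by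
  simp [torusChar, fourier_apply, smul_add, AddCircle.toCircle_add, Finset.prod_mul_distrib]

lemma torusChar_neg {d : ℕ} (k : Fin d → ℤ) (x : Torus d) :
    torusChar k (-x) = (starRingEnd ℂ) (torusChar k x) := by
  simp only [torusChar, map_prod, ← fourier_neg, Pi.neg_apply]
  simp [fourier_apply]

@[simp]
lemma torusChar_zero {d : ℕ} (x : Torus d) : torusChar 0 x = 1 := by
  simp [torusChar]

lemma torusChar_toTorus_re {d : ℕ} (k : Fin d → ℤ) (x : Fin d → ℝ) :
    (torusChar k (toTorus x)).re = Real.cos (∑ i, k i * x i) := by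
  have : torusChar k (toTorus x) = Complex.exp (((∑ i, k i * x i : ℝ) : ℂ) * Complex.I) := by
    simp only [torusChar, toTorus, fourier_coe_apply, ← Complex.exp_sum]
    congr 1
    push_cast
    rw [Finset.sum_mul]
    refine Finset.sum_congr rfl fun i _ => ?_
    have : (Real.pi : ℂ) ≠ 0 := by exact_mod_cast Real.pi_ne_zero
    field_simp
  rw [this, Complex.exp_ofReal_mul_I_re]

/-- A continuous kernel on the torus which is a Riesz profile of the squared distance to the
origin. -/
structure TorusKernel (d : ℕ) (s : ℝ) (φ : ℝ → ℝ) (F : Torus d → ℝ≥0∞) : Prop where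
  profile : RieszProfile d s φ
  continuous : Continuous F
  eq_ofReal : ∀ x, x ≠ 0 → F x = ENNReal.ofReal (φ (tnorm x ^ 2))
  le_zero : ∀ u : ℝ, 0 < u → ENNReal.ofReal (φ u) ≤ F 0

namespace TorusKernel

variable {d : ℕ} {s : ℝ} {φ : ℝ → ℝ} {F : Torus d → ℝ≥0∞}

lemma toTorus_ae (hd : 0 < d) (h : TorusKernel d s φ F) :
    ∀ᵐ x ∂volume.restrict (cube d), F (toTorus x) = ENNReal.ofReal (φ (∑ i, x i ^ 2)) ∧
      (F (toTorus x)).toReal = φ (∑ i, x i ^ 2) := by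
  filter_upwards [ae_restrict_of_ae (ae_forall_ne_zero d),
    ae_restrict_mem (isCompact_cube d).measurableSet] with x hx hxc
  have hr := sum_sq_pos hd hx
  have hx0 : toTorus x ≠ 0 := fun h0 => by
    rw [← tnorm_toTorus_sq hxc, h0, tnorm_eq_zero.2 rfl] at hr
    simp at hr
  rw [h.eq_ofReal _ hx0, tnorm_toTorus_sq hxc]
  exact ⟨rfl, ENNReal.toReal_ofReal
    (h.profile.nonneg _ hr (by linarith [sum_sq_le_of_mem_cube hxc]))⟩

lemma lintegral_lt_top (hd : 0 < d) (h : TorusKernel d s φ F) : ∫⁻ x, F x < ⊤ := by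
  rw [← (measurePreserving_toTorus d).lintegral_comp h.continuous.measurable,
    lintegral_congr_ae ((h.toTorus_ae hd).mono fun x hx => hx.1)]
  exact (h.profile.integrableOn_cube hd).lintegral_lt_top

lemma ae_lt_top (hd : 0 < d) (h : TorusKernel d s φ F) : ∀ᵐ x, F x < ⊤ :=
  MeasureTheory.ae_lt_top h.continuous.measurable (h.lintegral_lt_top hd).ne

lemma integrable_toReal (hd : 0 < d) (h : TorusKernel d s φ F) :
    Integrable fun x => (F x).toReal :=
  integrable_toReal_of_lintegral_ne_top h.continuous.measurable.aemeasurable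
    (h.lintegral_lt_top hd).ne

lemma integrable_mul_torusChar (hd : 0 < d) (h : TorusKernel d s φ F) (k : Fin d → ℤ) :
    Integrable fun z => ((F z).toReal : ℂ) * torusChar k (-z) := by
  refine (h.integrable_toReal hd).ofReal.mul_bdd (c := 1) ?_ ?_
  · exact Continuous.aestronglyMeasurable (by fun_prop)
  · exact Eventually.of_forall fun z => (norm_torusChar k _).le

lemma re_integral_mul_torusChar (hd : 0 < d) (h : TorusKernel d s φ F) (k : Fin d → ℤ) :
    (∫ z, ((F z).toReal : ℂ) * torusChar k (-z)).re =
      ∫ x in cube d, φ (∑ i, x i ^ 2) * Real.cos (∑ i, k i * x i) := by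
  rw [← RCLike.re_eq_complex_re, ← integral_re (h.integrable_mul_torusChar hd k)]
  have hm : AEStronglyMeasurable
      (fun z => RCLike.re (((F z).toReal : ℂ) * torusChar k (-z))) volume :=
    (h.integrable_mul_torusChar hd k).re.aestronglyMeasurable
  rw [← (measurePreserving_toTorus d).map_eq] at hm ⊢
  rw [integral_map (measurePreserving_toTorus d).measurable.aemeasurable hm]
  refine integral_congr_ae ((h.toTorus_ae hd).mono fun x hx => ?_)
  simp only [hx.2, RCLike.re_eq_complex_re, Complex.re_ofReal_mul, torusChar_neg,
    Complex.conj_re, torusChar_toTorus_re]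

end TorusKernel

/-- The normalized tent function of width `h` on the circle. -/
def tent (h : ℝ) (w : AddCircle (2 * Real.pi)) : ℝ := max 0 (h - ‖w‖) / h ^ 2

lemma tent_nonneg (h : ℝ) (w : AddCircle (2 * Real.pi)) : 0 ≤ tent h w :=
  div_nonneg (le_max_left _ _) (sq_nonneg _)

@[fun_prop]
lemma continuous_tent (h : ℝ) : Continuous (tent h) := by
  unfold tent
  fun_prop

lemma tent_le {h : ℝ} (hh : 0 < h) (w : AddCircle (2 * Real.pi)) : tent h w ≤ h⁻¹ := by
  rw [tent, div_le_iff₀ (by positivity)]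
  have : h⁻¹ * h ^ 2 = h := by field_simp
  rw [this]
  exact max_le hh.le (by linarith [norm_nonneg w])

lemma tent_eq_zero {h : ℝ} {w : AddCircle (2 * Real.pi)} (hw : h ≤ ‖w‖) : tent h w = 0 := by
  rw [tent, max_eq_left (by linarith), zero_div]

lemma integral_sub_mul_cos {a : ℝ} (ha : a ≠ 0) (h : ℝ) :
    ∫ x in (0 : ℝ)..h, (h - x) * Real.cos (a * x) = (1 - Real.cos (a * h)) / a ^ 2 := by
  have hd : ∀ x ∈ uIcc 0 h, HasDerivAt
      (fun x => (h - x) * (Real.sin (a * x) / a) - Real.cos (a * x) / a ^ 2)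
      ((h - x) * Real.cos (a * x)) x := by
    intro x _
    have h1 : HasDerivAt (fun x => a * x) a x := by simpa using (hasDerivAt_id x).const_mul a
    have h2 := ((hasDerivAt_id x).const_sub h).mul (h1.sin.div_const a)
    have h3 := h2.sub (h1.cos.div_const (a ^ 2))
    refine h3.congr_deriv ?_
    simp only [id]
    field_simp
    ring
  rw [intervalIntegral.integral_eq_sub_of_hasDerivAt hd
    (Continuous.intervalIntegrable (by fun_prop) _ _)]
  simp
  ring

/-- The Fourier coefficients of the tent function. -/
def tentCoeff (h : ℝ) (j : ℤ) : ℝ :=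
  if j = 0 then 1 / (2 * Real.pi) else (1 - Real.cos (j * h)) / (Real.pi * j ^ 2 * h ^ 2)

lemma integral_sub_mul_cos_int {h : ℝ} (hh : 0 < h) (j : ℤ) :
    ∫ x in (0 : ℝ)..h, (h - x) * Real.cos (j * x) = Real.pi * h ^ 2 * tentCoeff h j := by
  rw [tentCoeff]
  split_ifs with hj
  · simp only [hj, Int.cast_zero, zero_mul, Real.cos_zero, mul_one]
    rw [intervalIntegral.integral_sub (by simp) (by simp)]
    simp
    field_simp
    ring
  · have : (j : ℝ) ≠ 0 := by exact_mod_cast hj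
    rw [integral_sub_mul_cos this]
    field_simp

lemma fourierCoeff_tent {h : ℝ} (hh : 0 < h) (hp : h ≤ Real.pi) (j : ℤ) :
    fourierCoeff (fun w => (tent h w : ℂ)) j = tentCoeff h j := by
  rw [fourierCoeff_eq_intervalIntegral _ _ (-Real.pi),
    show -Real.pi + 2 * Real.pi = Real.pi by ring]
  set f : ℝ → ℂ := fun x => fourier (-j) (x : AddCircle (2 * Real.pi)) •
    (tent h (x : AddCircle (2 * Real.pi)) : ℂ) with hf
  have hfc : Continuous f := by
    have : Continuous fun x : ℝ => (x : AddCircle (2 * Real.pi)) := AddCircle.continuous_mk' _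
    have h1 : Continuous fun x : ℝ => tent h (x : AddCircle (2 * Real.pi)) :=
      (continuous_tent h).comp this
    have h2 : Continuous fun x : ℝ => fourier (-j) (x : AddCircle (2 * Real.pi)) :=
      (fourier (-j)).continuous.comp this
    exact h2.smul (Complex.continuous_ofReal.comp h1)
  have hfi : ∀ a b, IntervalIntegrable f volume a b := fun a b => hfc.intervalIntegrable a b
  have hsum : ∀ x ∈ uIcc 0 Real.pi, f (-x) + f x =
      ((2 * (max 0 (h - x) / h ^ 2) * Real.cos (j * x) : ℝ) : ℂ) := by
    intro x hx
    rw [uIcc_of_le Real.pi_pos.le] at hx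
    have hx' : |x| ≤ Real.pi := by rw [abs_of_nonneg hx.1]; exact hx.2
    have e1 : tent h (x : AddCircle (2 * Real.pi)) = max 0 (h - x) / h ^ 2 := by
      rw [tent, norm_coe_circle hx', abs_of_nonneg hx.1]
    have e2 : tent h ((-x : ℝ) : AddCircle (2 * Real.pi)) = max 0 (h - x) / h ^ 2 := by
      rw [tent, norm_coe_circle (by rwa [abs_neg]), abs_neg, abs_of_nonneg hx.1]
    simp only [hf, e1, e2, fourier_coe_apply, smul_eq_mul]
    have hpi : (Real.pi : ℂ) ≠ 0 := by exact_mod_cast Real.pi_ne_zero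
    have e3 : 2 * (Real.pi : ℂ) * Complex.I * ((-j : ℤ) : ℂ) * ((-x : ℝ) : ℂ) /
        ((2 * Real.pi : ℝ) : ℂ) = (j * x : ℂ) * Complex.I := by
      push_cast; field_simp
    have e4 : 2 * (Real.pi : ℂ) * Complex.I * ((-j : ℤ) : ℂ) * (x : ℂ) /
        ((2 * Real.pi : ℝ) : ℂ) = -(j * x : ℂ) * Complex.I := by
      push_cast; field_simp
    rw [e3, e4, ← add_mul]
    push_cast
    have := Complex.two_cos (j * x : ℂ)
    rw [← this]
    ring
  have hcInt : ∫ x in (-Real.pi)..Real.pi, f x =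
      ((2 / h ^ 2 * ∫ x in (0 : ℝ)..h, (h - x) * Real.cos (j * x) : ℝ) : ℂ) := by
    rw [← intervalIntegral.integral_add_adjacent_intervals (hfi _ 0) (hfi _ _)]
    have : ∫ x in (-Real.pi)..0, f x = ∫ x in (0 : ℝ)..Real.pi, f (-x) := by
      rw [intervalIntegral.integral_comp_neg, neg_zero]
    rw [this, ← intervalIntegral.integral_add
      (Continuous.intervalIntegrable (by fun_prop) _ _) (hfi _ _),
      intervalIntegral.integral_congr hsum, intervalIntegral.integral_ofReal]
    congr 1
    have hgi : ∀ a b, IntervalIntegrable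
        (fun x => 2 * (max 0 (h - x) / h ^ 2) * Real.cos (j * x)) volume a b :=
      fun a b => Continuous.intervalIntegrable (by fun_prop) _ _
    rw [← intervalIntegral.integral_add_adjacent_intervals (hgi 0 h) (hgi h _)]
    have z : ∫ x in h..Real.pi, 2 * (max 0 (h - x) / h ^ 2) * Real.cos (j * x) = 0 := by
      rw [intervalIntegral.integral_congr (g := fun _ => (0 : ℝ))]
      · simp
      · intro x hx
        rw [uIcc_of_le hp] at hx
        simp [max_eq_left (sub_nonpos.2 hx.1)]
    rw [z, add_zero, ← intervalIntegral.integral_const_mul]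
    refine intervalIntegral.integral_congr fun x hx => ?_
    rw [uIcc_of_le hh.le] at hx
    simp only [max_eq_right (sub_nonneg.2 hx.2)]
    ring
  rw [hcInt, integral_sub_mul_cos_int hh, Complex.real_smul, ← Complex.ofReal_mul]
  congr 1
  field_simp

lemma tentCoeff_zero (h : ℝ) : tentCoeff h 0 = 1 / (2 * Real.pi) := by simp [tentCoeff]

lemma tentCoeff_nonneg (h : ℝ) (j : ℤ) : 0 ≤ tentCoeff h j := by
  rw [tentCoeff]
  split_ifs
  · positivity
  · exact div_nonneg (by linarith [Real.cos_le_one (j * h)]) (by positivity)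

lemma le_tentCoeff {h : ℝ} (hh : 0 < h) {j : ℤ} (hj : |(j : ℝ)| * h ≤ Real.pi) :
    2 / Real.pi ^ 3 ≤ tentCoeff h j := by
  rw [tentCoeff]
  have hpi := Real.pi_gt_three
  split_ifs with h0
  · rw [div_le_div_iff₀ (by positivity) (by positivity)]
    nlinarith [mul_pos Real.pi_pos (show 0 < Real.pi ^ 2 - 4 by nlinarith)]
  · have : (j : ℝ) ≠ 0 := by exact_mod_cast h0
    have hc := Real.cos_le_one_sub_mul_cos_sq (x := j * h) (by rwa [abs_mul, abs_of_pos hh])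
    rw [le_div_iff₀ (by positivity)]
    calc _ = 2 / Real.pi ^ 2 * (j * h) ^ 2 := by field_simp
      _ ≤ _ := by linarith

lemma summable_tentCoeff {h : ℝ} (hh : 0 < h) : Summable (tentCoeff h) := by
  have h1 : Summable fun j : ℤ => 2 / (Real.pi * h ^ 2) * (1 / (j : ℝ) ^ 2) :=
    (Real.summable_one_div_int_pow.2 one_lt_two).mul_left _
  refine Summable.of_norm_bounded_eventually h1 ?_
  rw [Int.cofinite_eq]
  have : ∀ᶠ j : ℤ in cofinite, j ≠ 0 := (Set.finite_singleton 0).eventually_cofinite_notMem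
  rw [← Int.cofinite_eq]
  filter_upwards [this] with j hj
  rw [Real.norm_of_nonneg (tentCoeff_nonneg h j), tentCoeff, if_neg hj]
  have : (j : ℝ) ≠ 0 := by exact_mod_cast hj
  calc _ ≤ 2 / (Real.pi * j ^ 2 * h ^ 2) := by
        gcongr
        linarith [Real.neg_one_le_cos (j * h)]
    _ = _ := by field_simp

lemma hasSum_tent {h : ℝ} (hh : 0 < h) (hp : h ≤ Real.pi) (w : AddCircle (2 * Real.pi)) :
    HasSum (fun j : ℤ => (tentCoeff h j : ℂ) * fourier j w) (tent h w : ℂ) := by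
  have := has_pointwise_sum_fourier_series_of_summable
    (f := ⟨fun w => (tent h w : ℂ), by fun_prop⟩) (by
      refine (Complex.ofRealCLM.summable (summable_tentCoeff hh)).congr fun j => ?_
      exact (fourierCoeff_tent hh hp j).symm) w
  simpa only [fourierCoeff_tent hh hp, ContinuousMap.coe_mk, smul_eq_mul] using this

lemma integral_tent {h : ℝ} (hh : 0 < h) (hp : h ≤ Real.pi) : ∫ w, tent h w = 1 := by
  have := fourierCoeff_tent hh hp 0
  rw [tentCoeff_zero, fourierCoeff] at this
  simp only [neg_zero, fourier_zero, one_smul] at this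
  rw [AddCircle.integral_haarAddCircle, integral_complex_ofReal, Complex.real_smul,
    ← Complex.ofReal_mul] at this
  have h2 := Complex.ofReal_injective this
  field_simp at h2
  exact h2

/-- The product tent function on the torus. -/
def torusTent {d : ℕ} (h : ℝ) (z : Torus d) : ℝ := ∏ i, tent h (z i)

lemma torusTent_nonneg {d : ℕ} (h : ℝ) (z : Torus d) : 0 ≤ torusTent h z :=
  Finset.prod_nonneg fun _ _ => tent_nonneg _ _

@[fun_prop]
lemma continuous_torusTent {d : ℕ} (h : ℝ) : Continuous (torusTent h : Torus d → ℝ) := by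
  unfold torusTent
  fun_prop

lemma torusTent_le {d : ℕ} {h : ℝ} (hh : 0 < h) (z : Torus d) : torusTent h z ≤ (h⁻¹) ^ d := by
  calc torusTent h z ≤ ∏ _i : Fin d, h⁻¹ :=
        Finset.prod_le_prod (fun _ _ => tent_nonneg _ _) fun _ _ => tent_le hh _
    _ = _ := by simp

lemma torusTent_eq_zero {d : ℕ} {h : ℝ} {z : Torus d} {i : Fin d} (hi : h ≤ ‖z i‖) :
    torusTent h z = 0 :=
  Finset.prod_eq_zero (Finset.mem_univ i) (tent_eq_zero hi)

lemma integral_torusTent {d : ℕ} {h : ℝ} (hh : 0 < h) (hp : h ≤ Real.pi) :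
    ∫ z : Torus d, torusTent h z = 1 := by
  unfold torusTent
  rw [integral_fintype_prod_volume_eq_pow, integral_tent hh hp, one_pow]

lemma lintegral_torusTent_sub {d : ℕ} {h : ℝ} (hh : 0 < h) (hp : h ≤ Real.pi) (w : Torus d) :
    ∫⁻ z : Torus d, ENNReal.ofReal (torusTent h (w - z)) = 1 := by
  have : (volume : Measure (Torus d)).IsNegInvariant :=
    Measure.IsAddHaarMeasure.isNegInvariant_of_regular _
  rw [lintegral_sub_left_eq_self (fun z : Torus d => ENNReal.ofReal (torusTent h z)) w,
    ← ofReal_integral_eq_lintegral_ofReal ?_ (Eventually.of_forall fun z => torusTent_nonneg h z),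
    integral_torusTent hh hp, ENNReal.ofReal_one]
  exact (continuous_torusTent h).integrable_of_hasCompactSupport
    (HasCompactSupport.of_compactSpace _)

/-- Fourier coefficients of the product tent function. -/
def torusTentCoeff {d : ℕ} (h : ℝ) (k : Fin d → ℤ) : ℝ := ∏ i, tentCoeff h (k i)

lemma torusTentCoeff_nonneg {d : ℕ} (h : ℝ) (k : Fin d → ℤ) : 0 ≤ torusTentCoeff h k :=
  Finset.prod_nonneg fun _ _ => tentCoeff_nonneg _ _

lemma torusTentCoeff_zero {d : ℕ} (h : ℝ) :
    torusTentCoeff h (0 : Fin d → ℤ) = (1 / (2 * Real.pi)) ^ d := by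
  simp [torusTentCoeff, tentCoeff_zero]

lemma le_torusTentCoeff {d : ℕ} {h : ℝ} (hh : 0 < h) {k : Fin d → ℤ}
    (hk : ∀ i, |(k i : ℝ)| * h ≤ Real.pi) : (2 / Real.pi ^ 3) ^ d ≤ torusTentCoeff h k := by
  calc (2 / Real.pi ^ 3) ^ d = ∏ _i : Fin d, 2 / Real.pi ^ 3 := by simp [div_pow]
    _ ≤ _ := Finset.prod_le_prod (fun _ _ => by positivity) fun i _ => le_tentCoeff hh (hk i)

/-- The rectangular partial sums of the Fourier series of the product tent function. -/
def tentPoly {d : ℕ} (h : ℝ) (S : Finset ℤ) (z : Torus d) : ℂ :=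
  ∑ k ∈ Fintype.piFinset fun _ => S, (torusTentCoeff h k : ℂ) * torusChar k z

lemma tentPoly_eq_prod {d : ℕ} (h : ℝ) (S : Finset ℤ) (z : Torus d) :
    tentPoly h S z = ∏ i, ∑ j ∈ S, (tentCoeff h j : ℂ) * fourier j (z i) := by
  rw [Finset.prod_univ_sum, tentPoly]
  refine Finset.sum_congr rfl fun k _ => ?_
  simp [torusTentCoeff, torusChar, Finset.prod_mul_distrib]

@[fun_prop]
lemma continuous_tentPoly {d : ℕ} (h : ℝ) (S : Finset ℤ) :
    Continuous (tentPoly h S : Torus d → ℂ) := by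
  unfold tentPoly
  fun_prop

lemma tendsto_tentPoly {d : ℕ} {h : ℝ} (hh : 0 < h) (hp : h ≤ Real.pi) (z : Torus d) :
    Tendsto (fun S => tentPoly h S z) atTop (𝓝 (torusTent h z : ℂ)) := by
  simp only [tentPoly_eq_prod, torusTent, Complex.ofReal_prod]
  exact tendsto_finsetProd _ fun i _ => hasSum_tent hh hp (z i)

lemma norm_tentPoly_le {d : ℕ} {h : ℝ} (hh : 0 < h) (S : Finset ℤ) (z : Torus d) :
    ‖tentPoly h S z‖ ≤ (∑' j, tentCoeff h j) ^ d := by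
  rw [tentPoly_eq_prod, norm_prod]
  calc ∏ i, ‖∑ j ∈ S, (tentCoeff h j : ℂ) * fourier j (z i)‖
      ≤ ∏ _i : Fin d, ∑' j, tentCoeff h j := by
        refine Finset.prod_le_prod (fun _ _ => norm_nonneg _) fun i _ => ?_
        refine (norm_sum_le _ _).trans ?_
        refine le_trans (le_of_eq ?_)
          ((summable_tentCoeff hh).sum_le_tsum S fun j _ => tentCoeff_nonneg h j)
        refine Finset.sum_congr rfl fun j _ => ?_
        rw [norm_mul, Complex.norm_real, Real.norm_of_nonneg (tentCoeff_nonneg h j),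
          fourier_apply, Circle.norm_coe, mul_one]
    _ = _ := by simp

/-- The Fourier coefficients of a measure on the torus. -/
def torusFourier {d : ℕ} (μ : Measure (Torus d)) (k : Fin d → ℤ) : ℂ := ∫ x, torusChar k x ∂μ

lemma integrable_torusChar {d : ℕ} (μ : Measure (Torus d)) [IsFiniteMeasure μ] (k : Fin d → ℤ) :
    Integrable (torusChar k) μ :=
  (continuous_torusChar k).integrable_of_hasCompactSupport (HasCompactSupport.of_compactSpace _)

lemma torusFourier_zero {d : ℕ} (μ : Measure (Torus d)) [IsProbabilityMeasure μ] :
    torusFourier μ 0 = 1 := by simp [torusFourier]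

/-- Convolution of a kernel with the product tent function. -/
def tentSmooth {d : ℕ} (F : Torus d → ℝ≥0∞) (h : ℝ) (w : Torus d) : ℝ≥0∞ :=
  ∫⁻ z, F z * ENNReal.ofReal (torusTent h (w - z))

namespace TorusKernel

variable {d : ℕ} {s : ℝ} {φ : ℝ → ℝ} {F : Torus d → ℝ≥0∞}

/-- The energy against a trigonometric partial sum, in terms of Fourier coefficients. -/
lemma integral_tentPoly (hd : 0 < d) (hF : TorusKernel d s φ F) (μ : Measure (Torus d))
    [IsProbabilityMeasure μ] (h : ℝ) (S : Finset ℤ) :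
    (∫ p : (Torus d × Torus d) × Torus d, ((F p.2).toReal : ℂ) *
        tentPoly h S (p.1.1 - p.1.2 - p.2) ∂(μ.prod μ).prod volume) =
      ∑ k ∈ Fintype.piFinset fun _ => S, ((torusTentCoeff h k * ‖torusFourier μ k‖ ^ 2 : ℝ) : ℂ) *
        ∫ z, ((F z).toReal : ℂ) * torusChar k (-z) := by
  have hμ : ∀ k : Fin d → ℤ, Integrable (fun x => (starRingEnd ℂ) (torusChar k x)) μ := fun k =>
    Continuous.integrable_of_hasCompactSupport (by fun_prop) (HasCompactSupport.of_compactSpace _)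
  have key : ∀ p : (Torus d × Torus d) × Torus d,
      ((F p.2).toReal : ℂ) * tentPoly h S (p.1.1 - p.1.2 - p.2) =
      ∑ k ∈ Fintype.piFinset fun _ => S, (torusTentCoeff h k : ℂ) *
        ((torusChar k p.1.1 * (starRingEnd ℂ) (torusChar k p.1.2)) *
          (((F p.2).toReal : ℂ) * torusChar k (-p.2))) := by
    intro p
    rw [tentPoly, Finset.mul_sum]
    refine Finset.sum_congr rfl fun k _ => ?_
    rw [sub_eq_add_neg, sub_eq_add_neg, torusChar_add, torusChar_add, torusChar_neg k p.1.2]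
    ring
  simp only [key]
  rw [integral_finsetSum]
  · refine Finset.sum_congr rfl fun k _ => ?_
    rw [integral_const_mul,
      integral_prod_mul (μ := μ.prod μ) (ν := volume)
        (fun q : Torus d × Torus d => torusChar k q.1 * (starRingEnd ℂ) (torusChar k q.2))
        (fun z : Torus d => ((F z).toReal : ℂ) * torusChar k (-z)),
      integral_prod_mul (torusChar k) (fun x => (starRingEnd ℂ) (torusChar k x)), integral_conj,
      ← torusFourier, Complex.mul_conj, Complex.normSq_eq_norm_sq]
    push_cast
    ring
  · intro k _
    exact (((integrable_torusChar μ k).mul_prod (hμ k)).mul_prod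
      (hF.integrable_mul_torusChar hd k)).const_mul _

/-- Lower bound for the energy of the smoothed kernel. -/
lemma le_lintegral_tentSmooth (hd : 0 < d) (hs₁ : (d : ℝ) - 2 ≤ s) (hs₂ : s < d)
    (hF : TorusKernel d s φ F) (μ : Measure (Torus d)) [IsProbabilityMeasure μ]
    {h : ℝ} (hh : 0 < h) (hp : h ≤ Real.pi) {k : Fin d → ℤ} (hk : k ≠ 0)
    (hkh : ∀ i, |(k i : ℝ)| * h ≤ Real.pi) :
    ENNReal.ofReal ((1 / (2 * Real.pi)) ^ d * (∫ z, (F z).toReal) +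
      (2 / Real.pi ^ 3) ^ d * ‖torusFourier μ k‖ ^ 2 *
        ∫ x in cube d, φ (∑ i, x i ^ 2) * Real.cos (∑ i, k i * x i)) ≤
    ∫⁻ q, tentSmooth F h (q.1 - q.2) ∂μ.prod μ := by
  set ν := (μ.prod μ).prod (volume : Measure (Torus d))
  set g : (Torus d × Torus d) × Torus d → ℝ :=
    fun p => (F p.2).toReal * torusTent h (p.1.1 - p.1.2 - p.2)
  have hFi : Integrable (fun p : (Torus d × Torus d) × Torus d => (F p.2).toReal) ν :=
    (hF.integrable_toReal hd).comp_snd (μ.prod μ)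
  have hgi : Integrable g ν := by
    refine hFi.mul_bdd (c := (h⁻¹) ^ d) (Continuous.aestronglyMeasurable (by fun_prop))
      (Eventually.of_forall fun p => ?_)
    rw [Real.norm_of_nonneg (torusTent_nonneg _ _)]
    exact torusTent_le hh _
  have hlim : Tendsto (fun S => ∫ p, ((F p.2).toReal : ℂ) *
      tentPoly h S (p.1.1 - p.1.2 - p.2) ∂ν) atTop (𝓝 (∫ p, (g p : ℂ) ∂ν)) := by
    refine tendsto_integral_filter_of_dominated_convergence
      (fun p => (F p.2).toReal * (∑' j, tentCoeff h j) ^ d) ?_ ?_ (hFi.mul_const _) ?_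
    · exact Eventually.of_forall fun S => hFi.ofReal.aestronglyMeasurable.mul
        (Continuous.aestronglyMeasurable (by fun_prop))
    · refine Eventually.of_forall fun S => Eventually.of_forall fun p => ?_
      rw [norm_mul, Complex.norm_real, Real.norm_of_nonneg ENNReal.toReal_nonneg]
      gcongr
      exact norm_tentPoly_le hh S _
    · refine Eventually.of_forall fun p => ?_
      simp only [g, Complex.ofReal_mul]
      exact (tendsto_tentPoly hh hp _).const_mul _
  have hre := (Complex.continuous_re.tendsto _).comp hlim
  rw [integral_complex_ofReal, Complex.ofReal_re] at hre
  have hle : (1 / (2 * Real.pi)) ^ d * (∫ z, (F z).toReal) +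
      (2 / Real.pi ^ 3) ^ d * ‖torusFourier μ k‖ ^ 2 *
        (∫ x in cube d, φ (∑ i, x i ^ 2) * Real.cos (∑ i, k i * x i)) ≤ ∫ p, g p ∂ν := by
    refine ge_of_tendsto hre ?_
    filter_upwards [eventually_ge_atTop (insert 0 (Finset.univ.image k))] with S hS
    simp only [Function.comp, ν]
    rw [hF.integral_tentPoly hd μ h S, Complex.re_sum]
    simp only [Complex.re_ofReal_mul, hF.re_integral_mul_torusChar hd]
    have h0S : (0 : Fin d → ℤ) ∈ Fintype.piFinset fun _ => S := by
      simp only [Fintype.mem_piFinset]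
      exact fun _ => hS (Finset.mem_insert_self _ _)
    have hkS : k ∈ Fintype.piFinset fun _ => S := by
      simp only [Fintype.mem_piFinset]
      exact fun i => hS (Finset.mem_insert_of_mem (Finset.mem_image_of_mem _ (Finset.mem_univ i)))
    have hpos : ∀ k' : Fin d → ℤ, k' ≠ 0 →
        0 ≤ ∫ x in cube d, φ (∑ i, x i ^ 2) * Real.cos (∑ i, k' i * x i) :=
      fun k' hk' => hF.profile.integral_cos_nonneg hd hs₁ hs₂ hk'
    have hF0 : (∫ x in cube d, φ (∑ i, x i ^ 2) *
        Real.cos (∑ i, ((0 : Fin d → ℤ) i : ℝ) * x i)) = ∫ z, (F z).toReal := by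
      rw [← hF.re_integral_mul_torusChar hd 0]
      simp only [torusChar_zero, mul_one]
      rw [integral_complex_ofReal, Complex.ofReal_re]
    rw [← Finset.add_sum_erase _ _ h0S]
    refine add_le_add ?_ ?_
    · rw [hF0, torusFourier_zero, torusTentCoeff_zero]
      simp
    · refine le_trans ?_ (Finset.single_le_sum (f := fun k' => torusTentCoeff h k' *
        ‖torusFourier μ k'‖ ^ 2 *
          ∫ x in cube d, φ (∑ i, x i ^ 2) * Real.cos (∑ i, k' i * x i)) (fun k' hk' => ?_)
          (Finset.mem_erase.2 ⟨hk, hkS⟩))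
      · have := hpos k hk
        have := le_torusTentCoeff hh hkh
        gcongr
      · exact mul_nonneg (mul_nonneg (torusTentCoeff_nonneg _ _) (sq_nonneg _))
          (hpos k' (Finset.mem_erase.1 hk').1)
  refine (ENNReal.ofReal_le_ofReal hle).trans ?_
  rw [ofReal_integral_eq_lintegral_ofReal hgi (Eventually.of_forall fun p =>
    mul_nonneg ENNReal.toReal_nonneg (torusTent_nonneg _ _)),
    lintegral_prod _ hgi.aestronglyMeasurable.aemeasurable.ennreal_ofReal]
  refine lintegral_mono fun q => lintegral_mono fun z => ?_
  simp only [g]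
  rw [ENNReal.ofReal_mul ENNReal.toReal_nonneg]
  gcongr
  exact ENNReal.ofReal_toReal_le

end TorusKernel

lemma norm_le_tnorm {d : ℕ} (x : Torus d) (i : Fin d) : ‖x i‖ ≤ tnorm x := by
  refine abs_le_of_sq_le_sq' ?_ (tnorm_nonneg x) |>.2
  rw [tnorm_sq]
  exact Finset.single_le_sum (f := fun i => ‖x i‖ ^ 2) (fun _ _ => sq_nonneg _) (Finset.mem_univ i)

lemma tnorm_le_of_norm_le {d : ℕ} {x : Torus d} {h : ℝ} (hh : 0 ≤ h) (hx : ∀ i, ‖x i‖ ≤ h) :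
    tnorm x ≤ d * h := by
  refine abs_le_of_sq_le_sq' ?_ (by positivity) |>.2
  rw [tnorm_sq]
  calc ∑ i, ‖x i‖ ^ 2 ≤ ∑ _i : Fin d, h ^ 2 := by
        gcongr with i
        exact hx i
    _ = d * h ^ 2 := by simp
    _ ≤ (d * h) ^ 2 := by
        rw [mul_pow]
        gcongr
        exact_mod_cast Nat.le_self_pow two_ne_zero d

lemma tnorm_neg {d : ℕ} (x : Torus d) : tnorm (-x) = tnorm x := by simp [tnorm]

lemma lintegral_prod_truncPow_torus_le (d : ℕ) {a H : ℝ} (ha : a < 1) (hH : 0 < H) :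
    ∫⁻ z : Torus d, ENNReal.ofReal (∏ i, truncPow a H ‖z i‖) ≤
      ENNReal.ofReal ((2 * (H / (1 - a))) ^ d) := by
  have hm : Measurable fun z : Torus d => ENNReal.ofReal (∏ i, truncPow a H ‖z i‖) := by
    refine (Finset.measurable_prod _ fun i _ => ?_).ennreal_ofReal
    exact (measurable_truncPow a H).comp (measurable_pi_apply i).norm
  rw [← (measurePreserving_toTorus d).lintegral_comp hm]
  calc ∫⁻ x in cube d, ENNReal.ofReal (∏ i, truncPow a H ‖toTorus x i‖)
      = ∫⁻ x in cube d, ENNReal.ofReal (∏ i, truncPow a H (x i)) := by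
        refine setLIntegral_congr_fun (isCompact_cube d).measurableSet fun x hx => ?_
        simp only [toTorus, norm_coe_circle (abs_le_of_mem_cube hx _), truncPow_abs]
    _ ≤ ∫⁻ x : Fin d → ℝ, ENNReal.ofReal (∏ i, truncPow a H (x i)) := setLIntegral_le_lintegral _ _
    _ = _ := by
        rw [← ofReal_integral_eq_lintegral_ofReal (integrable_prod_truncPow d ha hH)
          (Eventually.of_forall fun x => Finset.prod_nonneg fun i _ => truncPow_nonneg hH.le _),
          integral_fintype_prod_volume_eq_pow, integral_truncPow ha hH, Fintype.card_fin]

lemma ae_torus_forall_ne_zero (d : ℕ) : ∀ᵐ z : Torus d, ∀ i, z i ≠ 0 := by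
  have : NullSingletonClass (volume : Measure (AddCircle (2 * Real.pi))) := ⟨fun x => by
    rw [← Metric.closedBall_zero, AddCircle.volume_closedBall]
    simp [Real.pi_pos.le]⟩
  rw [ae_all_iff]
  intro i
  exact Measure.ae_eval_ne (fun _ : Fin d => (volume : Measure (AddCircle (2 * Real.pi)))) i 0

lemma norm_sub_le_of_torusTent_ne_zero {d : ℕ} {h : ℝ} {w : Torus d} (hw : torusTent h w ≠ 0)
    (i : Fin d) : ‖w i‖ < h := by
  by_contra! hi
  exact hw (torusTent_eq_zero hi)

namespace TorusKernel

variable {d : ℕ} {s : ℝ} {φ : ℝ → ℝ} {F : Torus d → ℝ≥0∞}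

lemma ofReal_le (hF : TorusKernel d s φ F) {w : Torus d} {H : ℝ} (hH : 0 < H)
    (hw : tnorm w ≤ H) : ENNReal.ofReal (φ (H ^ 2)) ≤ F w := by
  by_cases h0 : w = 0
  · rw [h0]
    exact hF.le_zero _ (by positivity)
  · rw [hF.eq_ofReal w h0]
    have := tnorm_pos h0
    refine ENNReal.ofReal_le_ofReal (hF.profile.antitoneOn (mem_Ioi.2 (by positivity))
      (mem_Ioi.2 (by positivity)) (by gcongr))

lemma exists_tentSmooth_le (hd : 0 < d) (hF : TorusKernel d s φ F) :
    ∃ C D : ℝ, ∀ h : ℝ, 0 < h → 3 * (d * h) ≤ Real.pi → ∀ w,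
      tentSmooth F h w ≤ ENNReal.ofReal C * F w + ENNReal.ofReal D := by
  obtain ⟨q, A, B, hq, hqd, hA, hB, hg⟩ := hF.profile.growth
  have hd1 : (1 : ℝ) ≤ d := by exact_mod_cast hd
  have ha : q / d < 1 := (div_lt_one (by linarith)).2 hqd
  have ha' : 0 < 1 - q / d := by linarith
  set M : ℝ := 2 * (6 * d / (1 - q / d)) ^ d with hM
  have hM0 : 0 ≤ M := by positivity
  set P : ℝ := 1 + 2 ^ q with hP
  have hP0 : 0 ≤ P := by positivity
  refine ⟨A * P + A * M, B * P + B * M, fun h hh hhp w => ?_⟩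
  have hhpi : h ≤ Real.pi := by nlinarith
  have hclose : ∀ z, torusTent h (w - z) ≠ 0 → tnorm (w - z) ≤ d * h := fun z hz =>
    tnorm_le_of_norm_le hh.le fun i => (norm_sub_le_of_torusTent_ne_zero hz i).le
  rcases le_or_gt (2 * (d * h)) (tnorm w) with hw | hw
  · have hw0 : 0 < tnorm w := lt_of_lt_of_le (by positivity) hw
    have hw0' : w ≠ 0 := fun h0 => by simp [h0, tnorm_eq_zero.2] at hw0
    have hφ : 0 ≤ φ (tnorm w ^ 2) :=
      hF.profile.nonneg _ (by positivity) (by linarith [tnorm_sq_le w])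
    have hpt : ∀ z, F z * ENNReal.ofReal (torusTent h (w - z)) ≤
        (ENNReal.ofReal (A * P) * F w + ENNReal.ofReal (B * P)) *
          ENNReal.ofReal (torusTent h (w - z)) := by
      intro z
      by_cases hz : torusTent h (w - z) = 0
      · simp [hz]
      gcongr
      have h1 := hclose z hz
      have h2 := tnorm_add_le (w - z) z
      rw [sub_add_cancel] at h2
      have h3 : tnorm w / 2 ≤ tnorm z := by linarith
      have hz0 : 0 < tnorm z := by linarith
      have hz0' : z ≠ 0 := fun h0 => by simp [h0, tnorm_eq_zero.2] at hz0
      rw [hF.eq_ofReal z hz0', hF.eq_ofReal w hw0', ← ENNReal.ofReal_mul (by positivity),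
        ← ENNReal.ofReal_add (by positivity) (by positivity)]
      refine ENNReal.ofReal_le_ofReal ?_
      calc φ (tnorm z ^ 2) ≤ (A * φ (tnorm w ^ 2) + B) * (1 + (tnorm w / tnorm z) ^ q) :=
            hg _ _ hz0 hw0 (by linarith [tnorm_sq_le w])
        _ ≤ (A * φ (tnorm w ^ 2) + B) * P := by
            rw [hP]
            gcongr
            rw [div_le_iff₀ hz0]
            linarith
        _ = _ := by ring
    calc tentSmooth F h w ≤ ∫⁻ z, (ENNReal.ofReal (A * P) * F w + ENNReal.ofReal (B * P)) *
          ENNReal.ofReal (torusTent h (w - z)) := lintegral_mono hpt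
      _ = ENNReal.ofReal (A * P) * F w + ENNReal.ofReal (B * P) := by
          rw [lintegral_const_mul _ (Continuous.measurable (by fun_prop)).ennreal_ofReal,
            lintegral_torusTent_sub hh hhpi, mul_one]
      _ ≤ _ := by
          gcongr
          · linarith [mul_nonneg hA hM0]
          · linarith [mul_nonneg hB hM0]
  · set H : ℝ := 3 * (d * h) with hH
    have hH0 : 0 < H := by positivity
    have hHsq : H ^ 2 ≤ d * Real.pi ^ 2 + 1 := by
      have : H ^ 2 ≤ Real.pi ^ 2 := by gcongr
      nlinarith [sq_nonneg Real.pi]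
    have hφ : 0 ≤ φ (H ^ 2) := hF.profile.nonneg _ (by positivity) hHsq
    have hpt : ∀ᵐ z, F z * ENNReal.ofReal (torusTent h (w - z)) ≤
        ENNReal.ofReal ((A * φ (H ^ 2) + B) * 2 * (h⁻¹) ^ d) *
          ENNReal.ofReal (∏ i, truncPow (q / d) H ‖z i‖) := by
      filter_upwards [ae_torus_forall_ne_zero d] with z hz0
      by_cases hz : torusTent h (w - z) = 0
      · simp [hz]
      have h1 := hclose z hz
      have h2 := tnorm_add_le w (-(w - z))
      rw [tnorm_neg, show w + -(w - z) = z by abel] at h2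
      have hzH : ∀ i, |‖z i‖| ≤ H := fun i => by
        rw [abs_norm]
        exact (norm_le_tnorm z i).trans (by linarith)
      have hz0' : z ≠ 0 := fun h0 => hz0 ⟨0, hd⟩ (by rw [h0]; rfl)
      have hzpos := tnorm_pos hz0'
      have hle : φ (tnorm z ^ 2) ≤
          (A * φ (H ^ 2) + B) * (2 * ∏ i, truncPow (q / d) H ‖z i‖) := by
        refine (hg _ _ hzpos hH0 hHsq).trans ?_
        gcongr
        exact one_add_rpow_le_prod_truncPow hd hq (fun i => norm_ne_zero_iff.2 (hz0 i)) hzH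
      have hpr : 0 ≤ ∏ i, truncPow (q / d) H ‖z i‖ :=
        Finset.prod_nonneg fun i _ => truncPow_nonneg hH0.le _
      rw [hF.eq_ofReal z hz0',
        ← ENNReal.ofReal_mul (hF.profile.nonneg _ (by positivity) (by linarith [tnorm_sq_le z])),
        ← ENNReal.ofReal_mul (by positivity)]
      refine ENNReal.ofReal_le_ofReal ?_
      calc _ ≤ (A * φ (H ^ 2) + B) * (2 * ∏ i, truncPow (q / d) H ‖z i‖) * (h⁻¹) ^ d :=
            mul_le_mul hle (torusTent_le hh _) (torusTent_nonneg _ _) (by positivity)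
        _ = _ := by ring
    have hconst : (A * φ (H ^ 2) + B) * 2 * (h⁻¹) ^ d * (2 * (H / (1 - q / d))) ^ d =
        A * M * φ (H ^ 2) + B * M := by
      have : (h⁻¹) ^ d * (2 * (H / (1 - q / d))) ^ d = (6 * d / (1 - q / d)) ^ d := by
        rw [← mul_pow]
        congr 1
        rw [hH]
        field_simp
        ring
      rw [mul_assoc, this, hM]
      ring
    calc tentSmooth F h w ≤ ∫⁻ z : Torus d, ENNReal.ofReal ((A * φ (H ^ 2) + B) * 2 * (h⁻¹) ^ d) *
          ENNReal.ofReal (∏ i, truncPow (q / d) H ‖z i‖) := lintegral_mono_ae hpt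
      _ ≤ ENNReal.ofReal ((A * φ (H ^ 2) + B) * 2 * (h⁻¹) ^ d) *
          ENNReal.ofReal ((2 * (H / (1 - q / d))) ^ d) := by
          rw [lintegral_const_mul' _ _ ENNReal.ofReal_ne_top]
          gcongr
          exact lintegral_prod_truncPow_torus_le d ha hH0
      _ = ENNReal.ofReal (A * M) * ENNReal.ofReal (φ (H ^ 2)) + ENNReal.ofReal (B * M) := by
          rw [← ENNReal.ofReal_mul (by positivity), hconst,
            ENNReal.ofReal_add (by positivity) (by positivity),
            ENNReal.ofReal_mul (by positivity)]
      _ ≤ ENNReal.ofReal (A * M) * F w + ENNReal.ofReal (B * M) := by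
          gcongr
          exact hF.ofReal_le hH0 (by rw [hH]; linarith)
      _ ≤ _ := by
          gcongr
          · linarith [mul_nonneg hA hP0]
          · linarith [mul_nonneg hB hP0]

lemma measurable_tentSmooth (hF : TorusKernel d s φ F) (h : ℝ) : Measurable (tentSmooth F h) := by
  refine Measurable.lintegral_prod_right' (f := fun p : Torus d × Torus d =>
    F p.2 * ENNReal.ofReal (torusTent h (p.1 - p.2))) ?_
  exact (hF.continuous.measurable.comp measurable_snd).mul
    (Continuous.measurable (by fun_prop)).ennreal_ofReal

lemma limsup_tentSmooth_le (hF : TorusKernel d s φ F) {h : ℕ → ℝ} (h0 : ∀ n, 0 < h n)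
    (hp : ∀ n, h n ≤ Real.pi) (hlim : Tendsto h atTop (𝓝 0)) (w : Torus d) :
    limsup (fun n => tentSmooth F (h n) w) atTop ≤ F w := by
  refine le_of_forall_gt_imp_ge_of_dense fun b hb => ?_
  obtain ⟨ε, hε, hball⟩ := Metric.mem_nhds_iff.1 (hF.continuous.tendsto w (Iio_mem_nhds hb))
  refine limsup_le_of_le (by isBoundedDefault) ?_
  filter_upwards [hlim (Iio_mem_nhds hε)] with n hn
  calc tentSmooth F (h n) w ≤ ∫⁻ z, b * ENNReal.ofReal (torusTent (h n) (w - z)) := by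
        refine lintegral_mono fun z => ?_
        by_cases hz : torusTent (h n) (w - z) = 0
        · simp [hz]
        gcongr
        refine (hball (a := z) ?_).le
        rw [Metric.mem_ball, dist_comm, dist_eq_norm]
        exact (pi_norm_lt_iff hε).2 fun i => (norm_sub_le_of_torusTent_ne_zero hz i).trans hn
    _ = b := by
        rw [lintegral_const_mul _ (Continuous.measurable (by fun_prop)).ennreal_ofReal,
          lintegral_torusTent_sub (h0 n) (hp n), mul_one]

/-- Quantitative lower bound for the energy of a probability measure. -/
theorem le_energy (hd : 0 < d) (hs₁ : (d : ℝ) - 2 ≤ s) (hs₂ : s < d)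
    (hF : TorusKernel d s φ F) (μ : Measure (Torus d)) [IsProbabilityMeasure μ]
    {k : Fin d → ℤ} (hk : k ≠ 0) :
    ENNReal.ofReal ((1 / (2 * Real.pi)) ^ d * (∫ z, (F z).toReal) +
      (2 / Real.pi ^ 3) ^ d * ‖torusFourier μ k‖ ^ 2 *
        ∫ x in cube d, φ (∑ i, x i ^ 2) * Real.cos (∑ i, k i * x i)) ≤
    ∫⁻ q, F (q.1 - q.2) ∂μ.prod μ := by
  by_cases hfin : ∫⁻ q, F (q.1 - q.2) ∂μ.prod μ = ⊤
  · rw [hfin]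
    exact le_top
  obtain ⟨C, D, hCD⟩ := hF.exists_tentSmooth_le hd
  have hd1 : (1 : ℝ) ≤ d := by exact_mod_cast hd
  set m : ℝ := 3 * d + ∑ i, |(k i : ℝ)| with hm
  have hk0 : 0 ≤ ∑ i, |(k i : ℝ)| := Finset.sum_nonneg fun _ _ => abs_nonneg _
  have hm0 : 0 < m := by linarith
  set h : ℕ → ℝ := fun n => Real.pi / m * (1 / ((n : ℝ) + 1)) with hh
  have h0 : ∀ n, 0 < h n := fun n => by positivity
  have hmh : ∀ n, m * h n ≤ Real.pi := fun n => by
    have : m * h n = Real.pi * (1 / ((n : ℝ) + 1)) := by simp only [hh]; field_simp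
    rw [this]
    refine mul_le_of_le_one_right Real.pi_pos.le ?_
    rw [div_le_one (by positivity)]
    linarith [n.cast_nonneg (α := ℝ)]
  have hlim : Tendsto h atTop (𝓝 0) := by
    simpa [hh] using (tendsto_one_div_add_atTop_nhds_zero_nat (𝕜 := ℝ)).const_mul (Real.pi / m)
  have h3 : ∀ n, 3 * (d * h n) ≤ Real.pi := fun n => by
    nlinarith [hmh n, mul_nonneg hk0 (h0 n).le]
  have hp : ∀ n, h n ≤ Real.pi := fun n => by nlinarith [h3 n, h0 n]
  have hkh : ∀ n i, |(k i : ℝ)| * h n ≤ Real.pi := fun n i => by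
    have : |(k i : ℝ)| ≤ m := by
      have := Finset.single_le_sum (f := fun i => |(k i : ℝ)|) (fun _ _ => abs_nonneg _)
        (Finset.mem_univ i)
      linarith
    nlinarith [hmh n, h0 n]
  have hsub : Measurable fun q : Torus d × Torus d => q.1 - q.2 :=
    Continuous.measurable (by fun_prop)
  have hlow := fun n => hF.le_lintegral_tentSmooth hd hs₁ hs₂ μ (h0 n) (hp n) hk (hkh n)
  calc _ ≤ limsup (fun n => ∫⁻ q, tentSmooth F (h n) (q.1 - q.2) ∂μ.prod μ) atTop :=
        le_limsup_of_frequently_le (Frequently.of_forall hlow) (by isBoundedDefault)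
    _ ≤ ∫⁻ q, limsup (fun n => tentSmooth F (h n) (q.1 - q.2)) atTop ∂μ.prod μ := by
        refine limsup_lintegral_le
          (fun q => ENNReal.ofReal C * F (q.1 - q.2) + ENNReal.ofReal D)
          (fun n => (hF.measurable_tentSmooth _).comp hsub)
          (fun n => Eventually.of_forall fun q => hCD _ (h0 n) (h3 n) _) ?_
        rw [lintegral_add_right _ measurable_const,
          lintegral_const_mul' _ _ ENNReal.ofReal_ne_top]
        simp [ENNReal.mul_eq_top, hfin]
    _ ≤ _ := lintegral_mono fun q => hF.limsup_tentSmooth_le h0 hp hlim _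

end TorusKernel

instance isProbabilityMeasure_tHaar (d : ℕ) : IsProbabilityMeasure (tHaar d) := by
  refine ⟨?_⟩
  have h : (volume : Measure (Torus d)) univ = ENNReal.ofReal ((2 * Real.pi) ^ d) := by
    rw [← Set.pi_univ univ, volume_pi_pi]
    simp [AddCircle.measure_univ, ENNReal.ofReal_pow Real.two_pi_pos.le]
  rw [tHaar, Measure.smul_apply, h, smul_eq_mul]
  exact ENNReal.inv_mul_cancel (by simp [Real.pi_pos]) ENNReal.ofReal_ne_top

lemma lintegral_tHaar_sub {d : ℕ} (F : Torus d → ℝ≥0∞) (x : Torus d) :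
    ∫⁻ y, F (x - y) ∂tHaar d = (ENNReal.ofReal ((2 * Real.pi) ^ d))⁻¹ * ∫⁻ y, F y := by
  have : (volume : Measure (Torus d)).IsNegInvariant :=
    Measure.IsAddHaarMeasure.isNegInvariant_of_regular _
  rw [tHaar, lintegral_smul_measure, lintegral_sub_left_eq_self F x, smul_eq_mul]

namespace TorusKernel

variable {d : ℕ} {s : ℝ} {φ : ℝ → ℝ} {F : Torus d → ℝ≥0∞}

lemma energy_tHaar (hd : 0 < d) (hF : TorusKernel d s φ F) :
    ∫⁻ x, ∫⁻ y, F (x - y) ∂tHaar d ∂tHaar d =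
      ENNReal.ofReal ((1 / (2 * Real.pi)) ^ d * ∫ z, (F z).toReal) := by
  simp only [lintegral_tHaar_sub, lintegral_const, measure_univ, mul_one]
  rw [ENNReal.ofReal_mul (by positivity), integral_toReal hF.continuous.aemeasurable
    (hF.ae_lt_top hd), ENNReal.ofReal_toReal (hF.lintegral_lt_top hd).ne,
    ← ENNReal.ofReal_inv_of_pos (by positivity), one_div, inv_pow]

lemma lintegral_prod_sub (hF : TorusKernel d s φ F) (μ : Measure (Torus d))
    [IsProbabilityMeasure μ] :
    ∫⁻ q, F (q.1 - q.2) ∂μ.prod μ = ∫⁻ x, ∫⁻ y, F (x - y) ∂μ ∂μ :=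
  lintegral_prod _ (hF.continuous.comp continuous_sub).aemeasurable

/-- Haar measure minimizes the energy of a torus kernel. -/
theorem energy_tHaar_le (hd : 0 < d) (hs₁ : (d : ℝ) - 2 ≤ s) (hs₂ : s < d)
    (hF : TorusKernel d s φ F) (μ : Measure (Torus d)) [IsProbabilityMeasure μ] :
    ∫⁻ x, ∫⁻ y, F (x - y) ∂tHaar d ∂tHaar d ≤ ∫⁻ x, ∫⁻ y, F (x - y) ∂μ ∂μ := by
  have hk : (fun _ => 1 : Fin d → ℤ) ≠ 0 := fun h => one_ne_zero (congrFun h ⟨0, hd⟩)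
  rw [hF.energy_tHaar hd, ← hF.lintegral_prod_sub]
  refine le_trans (ENNReal.ofReal_le_ofReal ?_) (hF.le_energy hd hs₁ hs₂ μ hk)
  have := hF.profile.integral_cos_nonneg hd hs₁ hs₂ hk
  have : 0 ≤ (2 / Real.pi ^ 3) ^ d * ‖torusFourier μ fun _ => 1‖ ^ 2 := by positivity
  exact le_add_of_nonneg_right (mul_nonneg this ‹_›)

lemma torusFourier_eq_zero (hd : 0 < d) (hs₁ : (d : ℝ) - 2 < s) (hs₂ : s < d)
    (hF : TorusKernel d s φ F) {μ : Measure (Torus d)} [IsProbabilityMeasure μ]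
    (hμ : ∫⁻ x, ∫⁻ y, F (x - y) ∂μ ∂μ ≤ ∫⁻ x, ∫⁻ y, F (x - y) ∂tHaar d ∂tHaar d)
    {k : Fin d → ℤ} (hk : k ≠ 0) : torusFourier μ k = 0 := by
  have h1 := hF.le_energy hd hs₁.le hs₂ μ hk
  rw [hF.lintegral_prod_sub] at h1
  have h2 := h1.trans hμ
  have h0 : 0 ≤ ∫ z, (F z).toReal := integral_nonneg fun _ => ENNReal.toReal_nonneg
  rw [hF.energy_tHaar hd, ENNReal.ofReal_le_ofReal_iff (by positivity)] at h2
  have hpos := hF.profile.integral_cos_pos hd hs₁ hs₂ hk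
  by_contra hne
  have : 0 < ‖torusFourier μ k‖ := norm_pos_iff.2 hne
  have : 0 < (2 / Real.pi ^ 3) ^ d * ‖torusFourier μ k‖ ^ 2 *
      ∫ x in cube d, φ (∑ i, x i ^ 2) * Real.cos (∑ i, k i * x i) := by positivity
  linarith

end TorusKernel

/-- A probability measure whose nontrivial Fourier coefficients vanish has full support. -/
lemma msupp_eq_univ_of_torusFourier_eq_zero {d : ℕ} {μ : Measure (Torus d)}
    [IsProbabilityMeasure μ] (hμ : ∀ k : Fin d → ℤ, k ≠ 0 → torusFourier μ k = 0) :
    msupp μ = univ := by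
  refine eq_univ_of_forall fun x₀ V hV hxV => ?_
  by_contra hV0
  have hV0 : μ V = 0 := by simpa using hV0
  obtain ⟨ε, hε, hball⟩ := Metric.isOpen_iff.1 hV x₀ hxV
  set h := min ε Real.pi with hhdef
  have hh : 0 < h := lt_min hε Real.pi_pos
  have hp : h ≤ Real.pi := min_le_right _ _
  have hzero : ∫ x, (torusTent h (x₀ - x) : ℂ) ∂μ = 0 := by
    refine integral_eq_zero_of_ae ?_
    filter_upwards [measure_eq_zero_iff_ae_notMem.1 hV0] with x hx
    by_contra hne
    refine hx (hball ?_)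
    have hne' : torusTent h (x₀ - x) ≠ 0 := fun h0 => hne (by simp [h0])
    rw [Metric.mem_ball, dist_comm, dist_eq_norm]
    exact (pi_norm_lt_iff hε).2 fun i =>
      (norm_sub_le_of_torusTent_ne_zero hne' i).trans_le (min_le_left _ _)
  have hlim : Tendsto (fun S => ∫ x, tentPoly h S (x₀ - x) ∂μ) atTop
      (𝓝 (∫ x, (torusTent h (x₀ - x) : ℂ) ∂μ)) := by
    refine tendsto_integral_filter_of_dominated_convergence
      (fun _ => (∑' j, tentCoeff h j) ^ d) ?_ ?_ (integrable_const _) ?_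
    · exact Eventually.of_forall fun S => Continuous.aestronglyMeasurable (by fun_prop)
    · exact Eventually.of_forall fun S => Eventually.of_forall fun x => norm_tentPoly_le hh S _
    · exact Eventually.of_forall fun x => tendsto_tentPoly hh hp _
  have hconst : ∀ᶠ S in atTop, (∫ x, tentPoly h S (x₀ - x) ∂μ) =
      ((torusTentCoeff h (0 : Fin d → ℤ) : ℝ) : ℂ) := by
    filter_upwards [eventually_ge_atTop {0}] with S hS
    have h0S : (0 : Fin d → ℤ) ∈ Fintype.piFinset fun _ => S := by
      simp only [Fintype.mem_piFinset]
      exact fun _ => hS (Finset.mem_singleton_self _)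
    simp only [tentPoly, sub_eq_add_neg, torusChar_add, torusChar_neg]
    rw [integral_finsetSum]
    · simp only [integral_const_mul, integral_conj]
      rw [Finset.sum_eq_single_of_mem 0 h0S]
      · simp
      · intro k _ hk
        have : ∫ x, torusChar k x ∂μ = 0 := hμ k hk
        simp [this]
    · intro k _
      exact Continuous.integrable_of_hasCompactSupport (by fun_prop)
        (HasCompactSupport.of_compactSpace _)
  have := tendsto_nhds_unique (hlim.congr' hconst) tendsto_const_nhds
  rw [hzero, torusTentCoeff_zero] at this
  have h2 : (0 : ℝ) = (1 / (2 * Real.pi)) ^ d := by exact_mod_cast this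
  have h3 : 0 < (1 / (2 * Real.pi)) ^ d := by positivity
  linarith

lemma eEnergy_eq_sub {d : ℕ} {F : Torus d → ℝ≥0∞} (hF : Continuous F)
    {K : Torus d → Torus d → EReal} {b : ℝ} (hb : 0 ≤ b)
    (hK : ∀ x y, F (x - y) + toe (-(K x y)) = toe (K x y) + ENNReal.ofReal b)
    (hKb : ∀ x y, toe (-(K x y)) ≤ ENNReal.ofReal b)
    (μ : Measure (Torus d)) [IsProbabilityMeasure μ] :
    eEnergy K μ = ((∫⁻ x, ∫⁻ y, F (x - y) ∂μ ∂μ : ℝ≥0∞) : EReal) - (b : EReal) := by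
  have hF' : Measurable fun q : Torus d × Torus d => F (q.1 - q.2) :=
    (hF.comp continuous_sub).measurable
  have hsum : ∫⁻ x, ∫⁻ y, F (x - y) ∂μ ∂μ + ∫⁻ x, ∫⁻ y, toe (-(K x y)) ∂μ ∂μ =
      ∫⁻ x, ∫⁻ y, toe (K x y) ∂μ ∂μ + ENNReal.ofReal b := by
    rw [← lintegral_add_left hF'.lintegral_prod_right']
    have h1 : ∀ x, ∫⁻ y, F (x - y) ∂μ + ∫⁻ y, toe (-(K x y)) ∂μ =
        ∫⁻ y, toe (K x y) ∂μ + ENNReal.ofReal b := by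
      intro x
      rw [← lintegral_add_left (f := fun y => F (x - y)) (Continuous.measurable (by fun_prop))]
      simp only [hK]
      rw [lintegral_add_right _ measurable_const]
      simp
    simp only [h1]
    rw [lintegral_add_right _ measurable_const]
    simp
  have hN : ∫⁻ x, ∫⁻ y, toe (-(K x y)) ∂μ ∂μ ≠ ⊤ := by
    refine ne_top_of_le_ne_top (ENNReal.ofReal_ne_top (r := b)) ?_
    calc _ ≤ ∫⁻ _x, ∫⁻ _y, ENNReal.ofReal b ∂μ ∂μ :=
          lintegral_mono fun x => lintegral_mono fun y => hKb x y
      _ = _ := by simp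
  rw [eEnergy]
  generalize ∫⁻ x, ∫⁻ y, F (x - y) ∂μ ∂μ = E at *
  generalize ∫⁻ x, ∫⁻ y, toe (-(K x y)) ∂μ ∂μ = N at *
  generalize ∫⁻ x, ∫⁻ y, toe (K x y) ∂μ ∂μ = P at *
  lift N to NNReal using hN
  by_cases hP : P = ⊤
  · have hE : E = ⊤ := by
      by_contra hE
      lift E to NNReal using hE
      rw [hP, top_add] at hsum
      exact absurd hsum (by simp)
    rw [hP, hE]
    rfl
  · have hE : E ≠ ⊤ := by
      rintro rfl
      rw [top_add] at hsum
      exact ENNReal.add_ne_top.2 ⟨hP, ENNReal.ofReal_ne_top⟩ hsum.symm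
    lift P to NNReal using hP
    lift E to NNReal using hE
    have h2 : (E : ℝ) + N = P + b := by
      have := congrArg ENNReal.toReal hsum
      rwa [ENNReal.toReal_add (by simp) (by simp), ENNReal.toReal_add (by simp) (by simp),
        ENNReal.toReal_ofReal hb] at this
    change ((P : ℝ) : EReal) - ((N : ℝ) : EReal) = ((E : ℝ) : EReal) - (b : EReal)
    rw [← EReal.coe_sub, ← EReal.coe_sub]
    congr 1
    linarith

lemma toe_coe_real (a : ℝ) : toe (a : EReal) = ENNReal.ofReal a := by simp [toe]

lemma toe_coe_ennreal (a : ℝ≥0∞) : toe (a : EReal) = a := by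
  rw [toe]
  split_ifs with h
  · exact (EReal.coe_ennreal_eq_top_iff.1 h).symm
  · rw [EReal.toReal_coe_ennreal, ENNReal.ofReal_toReal (by simpa using h)]

lemma toe_neg_coe_ennreal (a : ℝ≥0∞) : toe (-(a : EReal)) = 0 := by
  rw [toe, if_neg]
  · simp
  · intro h
    have : (a : EReal) = ⊥ := by rw [← neg_neg (a : EReal), h]; rfl
    exact EReal.coe_ennreal_ne_bot _ this

lemma ofReal_add_ofReal_neg {a b : ℝ} (hb : 0 ≤ b) (hab : 0 ≤ b + a) :
    ENNReal.ofReal (b + a) + ENNReal.ofReal (-a) = ENNReal.ofReal a + ENNReal.ofReal b := by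
  rcases le_total 0 a with ha | ha
  · rw [ENNReal.ofReal_of_nonpos (neg_nonpos.2 ha), add_zero, ENNReal.ofReal_add hb ha, add_comm]
  · rw [ENNReal.ofReal_of_nonpos ha, zero_add, ← ENNReal.ofReal_add hab (neg_nonneg.2 ha)]
    congr 1
    ring

lemma sq_rpow_half {t : ℝ} (ht : 0 ≤ t) (s : ℝ) : (t ^ 2) ^ (-(s / 2)) = t ^ (-s) := by
  rw [← Real.rpow_natCast, ← Real.rpow_mul ht]
  congr 1
  push_cast
  ring

lemma rieszProfile_rpow {d : ℕ} {s : ℝ} (hs : 0 < s) (hsd : s < d) :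
    RieszProfile d s fun u => u ^ (-(s / 2)) where
  measurable := by fun_prop
  hasDerivAt := by
    refine ⟨s / 2, by positivity, fun u hu => ?_⟩
    refine (Real.hasDerivAt_rpow_const (Or.inl hu.ne')).congr_deriv ?_
    rw [show -(s / 2) - 1 = -(s / 2 + 1) by ring]
    ring
  nonneg := fun u hu _ => by positivity
  growth := by
    refine ⟨s, 1, 0, hs, hsd, zero_le_one, le_rfl, fun r H hr hH _ => ?_⟩
    rw [sq_rpow_half hr.le, sq_rpow_half hH.le, Real.div_rpow hH.le hr.le,
      Real.rpow_neg hr.le, Real.rpow_neg hH.le]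
    have h1 : 0 < H ^ s := by positivity
    have h2 : 0 < r ^ s := by positivity
    have : (1 * (H ^ s)⁻¹ + 0) * (1 + H ^ s / r ^ s) = (H ^ s)⁻¹ + (r ^ s)⁻¹ := by
      rw [one_mul, add_zero]
      field_simp
    rw [this]
    linarith [inv_pos.2 h1]

lemma rieszProfile_log {d : ℕ} (hd : 0 < d) :
    RieszProfile d 0 fun u => (Real.log (d * Real.pi ^ 2 + 1) - Real.log u) / 2 where
  measurable := by fun_prop
  hasDerivAt := by
    refine ⟨1 / 2, by norm_num, fun u hu => ?_⟩
    refine (((Real.hasDerivAt_log hu.ne').const_sub _).div_const 2).congr_deriv ?_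
    rw [zero_div, zero_add, Real.rpow_neg_one]
    ring
  nonneg := fun u hu hU => by linarith [Real.log_le_log hu hU]
  growth := by
    have hd1 : (1 : ℝ) ≤ d := by exact_mod_cast hd
    refine ⟨1 / 2, 1, 2, by norm_num, by linarith, zero_le_one, zero_le_two,
      fun r H hr hH hHU => ?_⟩
    have hH0 := Real.log_le_log (by positivity) hHU
    have h1 := Real.log_le_rpow_div (x := H / r) (by positivity) (ε := 1 / 2) (by norm_num)
    rw [Real.log_div hH.ne' hr.ne'] at h1
    rw [Real.log_pow] at hH0
    simp only [Real.log_pow]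
    push_cast at hH0 ⊢
    have h2 : 0 ≤ (H / r) ^ (1 / 2 : ℝ) := by positivity
    generalize (H / r) ^ (1 / 2 : ℝ) = t at *
    nlinarith [mul_nonneg h2 (sub_nonneg.2 hH0)]

lemma rieszProfile_rpow_of_neg {d : ℕ} (hd : 0 < d) {s : ℝ} (hs : s < 0) :
    RieszProfile d s fun u => (d * Real.pi ^ 2 + 1) ^ (-(s / 2)) - u ^ (-(s / 2)) where
  measurable := by fun_prop
  hasDerivAt := by
    refine ⟨-(s / 2), by linarith, fun u hu => ?_⟩
    refine ((Real.hasDerivAt_rpow_const (Or.inl hu.ne')).const_sub _).congr_deriv ?_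
    rw [show -(s / 2) - 1 = -(s / 2 + 1) by ring]
  nonneg := fun u hu hU => sub_nonneg.2 (Real.rpow_le_rpow hu.le hU (by linarith))
  growth := by
    have hd1 : (1 : ℝ) ≤ d := by exact_mod_cast hd
    have hB : (0 : ℝ) ≤ (d * Real.pi ^ 2 + 1) ^ (-(s / 2)) := by positivity
    refine ⟨1 / 2, 0, (d * Real.pi ^ 2 + 1) ^ (-(s / 2)), by norm_num, by linarith, le_rfl, hB,
      fun r H hr hH _ => ?_⟩
    have h1 : 0 ≤ (r ^ 2) ^ (-(s / 2)) := by positivity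
    have h2 : 0 ≤ (H / r) ^ (1 / 2 : ℝ) := by positivity
    nlinarith [mul_nonneg hB h2]

lemma tnorm_zero {d : ℕ} : tnorm (0 : Torus d) = 0 := tnorm_eq_zero.2 rfl

lemma torusKernel_rpow {d : ℕ} {s : ℝ} (hs : 0 < s) (hsd : s < d) :
    TorusKernel d s (fun u => u ^ (-(s / 2)))
      fun x => ENNReal.ofReal (tnorm x) ^ (-s) where
  profile := rieszProfile_rpow hs hsd
  continuous := ENNReal.continuous_rpow_const.comp
    (ENNReal.continuous_ofReal.comp continuous_tnorm)
  eq_ofReal := fun x hx => by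
    rw [ENNReal.ofReal_rpow_of_pos (tnorm_pos hx), sq_rpow_half (tnorm_nonneg x)]
  le_zero := fun u _ => by
    rw [tnorm_zero, ENNReal.ofReal_zero, ENNReal.zero_rpow_of_neg (by linarith)]
    exact le_top

lemma torusKernel_log {d : ℕ} (hd : 0 < d) :
    TorusKernel d 0 (fun u => (Real.log (d * Real.pi ^ 2 + 1) - Real.log u) / 2) fun x =>
      (-(ENNReal.log (ENNReal.ofReal (tnorm x / √(d * Real.pi ^ 2 + 1))))).toENNReal where
  profile := rieszProfile_log hd
  continuous := by
    refine EReal.continuous_toENNReal.comp (continuous_neg.comp (ENNReal.continuous_log.comp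
      (ENNReal.continuous_ofReal.comp (continuous_tnorm.div_const _))))
  eq_ofReal := fun x hx => by
    have hx0 := tnorm_pos hx
    rw [ENNReal.log_ofReal_of_pos (by positivity), ← EReal.coe_neg, EReal.toENNReal_of_ne_top
      (EReal.coe_ne_top _), EReal.toReal_coe, Real.log_div hx0.ne' (by positivity),
      Real.log_sqrt (by positivity), Real.log_pow]
    congr 1
    push_cast
    ring
  le_zero := fun u _ => by simp [tnorm_zero]

lemma torusKernel_rpow_of_neg {d : ℕ} (hd : 0 < d) {s : ℝ} (hs : s < 0) :
    TorusKernel d s (fun u => (d * Real.pi ^ 2 + 1) ^ (-(s / 2)) - u ^ (-(s / 2))) fun x =>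
      ENNReal.ofReal ((d * Real.pi ^ 2 + 1) ^ (-(s / 2)) - tnorm x ^ (-s)) where
  profile := rieszProfile_rpow_of_neg hd hs
  continuous := by
    refine ENNReal.continuous_ofReal.comp (continuous_const.sub ?_)
    exact continuous_tnorm.rpow_const fun _ => Or.inr (by linarith)
  eq_ofReal := fun x hx => by rw [sq_rpow_half (tnorm_nonneg x)]
  le_zero := fun u hu => by
    rw [tnorm_zero, Real.zero_rpow (by linarith)]
    refine ENNReal.ofReal_le_ofReal ?_
    have : 0 ≤ u ^ (-(s / 2)) := by positivity
    linarith

/-- Up to an additive constant, the Riesz kernel is a torus kernel. -/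
lemma exists_torusKernel_rieszK {d : ℕ} (hd : 0 < d) {s : ℝ} (hsd : s < d) :
    ∃ (φ : ℝ → ℝ) (F : Torus d → ℝ≥0∞) (b : ℝ), TorusKernel d s φ F ∧ 0 ≤ b ∧
      (∀ x y, F (x - y) + toe (-(rieszK s x y)) = toe (rieszK s x y) + ENNReal.ofReal b) ∧
      ∀ x y : Torus d, toe (-(rieszK s x y)) ≤ ENNReal.ofReal b := by
  have hd1 : (1 : ℝ) ≤ d := by exact_mod_cast hd
  rcases lt_trichotomy s 0 with hs | rfl | hs
  · refine ⟨_, _, (d * Real.pi ^ 2 + 1) ^ (-(s / 2)), torusKernel_rpow_of_neg hd hs,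
      by positivity, fun x y => ?_, fun x y => ?_⟩
    all_goals
      simp only [rieszK, if_neg hs.not_gt, if_neg hs.ne, tdist_eq_tnorm, ← EReal.coe_neg,
        toe_coe_real]
      have hle : tnorm (x - y) ^ (-s) ≤ (d * Real.pi ^ 2 + 1) ^ (-(s / 2)) := by
        rw [← sq_rpow_half (tnorm_nonneg _)]
        exact Real.rpow_le_rpow (sq_nonneg _) (by linarith [tnorm_sq_le (x - y)]) (by linarith)
    · rw [sub_eq_add_neg]
      exact ofReal_add_ofReal_neg (by positivity) (by linarith)
    · rw [neg_neg]
      exact ENNReal.ofReal_le_ofReal hle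
  · have hb : 0 ≤ Real.log (√(d * Real.pi ^ 2 + 1)) :=
      Real.log_nonneg (Real.one_le_sqrt.2 (by nlinarith [sq_nonneg Real.pi]))
    refine ⟨_, _, Real.log (√(d * Real.pi ^ 2 + 1)), torusKernel_log hd, hb,
      fun x y => ?_, fun x y => ?_⟩
    all_goals
      simp only [rieszK, lt_irrefl, if_false, if_true, tdist_eq_tnorm]
      by_cases h0 : tnorm (x - y) = 0
      · simp [h0, toe]
      have hpos : 0 < tnorm (x - y) := (tnorm_nonneg _).lt_of_ne' h0
      have hle : Real.log (tnorm (x - y)) ≤ Real.log (√(d * Real.pi ^ 2 + 1)) :=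
        Real.log_le_log hpos (Real.le_sqrt_of_sq_le (by linarith [tnorm_sq_le (x - y)]))
      simp only [if_neg h0, ← EReal.coe_neg, toe_coe_real]
    · rw [ENNReal.log_ofReal_of_pos (by positivity), ← EReal.coe_neg, EReal.toENNReal_of_ne_top
        (EReal.coe_ne_top _), EReal.toReal_coe, Real.log_div hpos.ne' (by positivity),
        neg_sub, sub_eq_add_neg]
      exact ofReal_add_ofReal_neg hb (by linarith)
    · rw [neg_neg]
      exact ENNReal.ofReal_le_ofReal hle
  · refine ⟨_, _, 0, torusKernel_rpow hs hsd, le_rfl, fun x y => ?_, fun x y => ?_⟩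
    · simp only [rieszK, if_pos hs, tdist_eq_tnorm, toe_coe_ennreal, toe_neg_coe_ennreal,
        ENNReal.ofReal_zero]
    · simp only [rieszK, if_pos hs, toe_neg_coe_ennreal, ENNReal.ofReal_zero, le_refl]

/-- On the flat `d`-torus, for `d − 2 ≤ s < d` the normalized Haar measure minimizes the
Riesz `s`-energy over all Borel probability measures, and for `d − 2 < s < d` every
minimizing measure has full support. -/
theorem haar_minimizes_riesz_energy_on_torus
    (d : ℕ) (hd : 1 ≤ d) (s : ℝ) (hs₁ : (d : ℝ) - 2 ≤ s) (hs₂ : s < d) :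
    (∀ μ : Measure (Torus d), IsProbabilityMeasure μ →
      eEnergy (rieszK s) (tHaar d) ≤ eEnergy (rieszK s) μ) ∧
    ((d : ℝ) - 2 < s → ∀ μ : Measure (Torus d), IsProbabilityMeasure μ →
      (∀ ν : Measure (Torus d), IsProbabilityMeasure ν →
        eEnergy (rieszK s) μ ≤ eEnergy (rieszK s) ν) →
      msupp μ = Set.univ) := by
  obtain ⟨φ, F, b, hF, hb, hK, hKb⟩ := exists_torusKernel_rieszK (s := s) hd hs₂
  have heq := fun (μ : Measure (Torus d)) [IsProbabilityMeasure μ] =>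
    eEnergy_eq_sub hF.continuous hb hK hKb μ
  refine ⟨fun μ hμ => ?_, fun hs μ hμ hmin => ?_⟩
  · rw [heq, heq]
    exact EReal.sub_le_sub (EReal.coe_ennreal_le_coe_ennreal_iff.2
      (hF.energy_tHaar_le hd hs₁ hs₂ μ)) le_rfl
  · have h := hmin (tHaar d) inferInstance
    rw [heq, heq] at h
    have h' := add_le_add_left h (b : EReal)
    simp only [EReal.sub_add_cancel] at h'
    exact msupp_eq_univ_of_torusFourier_eq_zero fun k hk =>
      hF.torusFourier_eq_zero hd hs hs₂ (EReal.coe_ennreal_le_coe_ennreal_iff.1 h') hk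

end
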